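/- arXiv:1610.01324 — 2 statements merged into one kernel-verified Lean document; each statement's English description precedes it below -/
import Mathlib

section
/- (Local truncation error of the implicit SDG scheme.) Fix p ≥ 0 and a quadrature rule on [−1,1] with nodes −1 < s_0 < ⋯ < s_p = 1 and positive weights ω_i exact for degree 2p; let ℓ_i be the Lagrange basis, L_{ij} = ∫_{−1}^{1} ℓ_i′ ℓ_j dt − δ_{ip} δ_{jp}, assume L invertible with inverse entries l^{−1}_{ij}, and define L̃ by L̃_{0,j} = −l^{−1}_{0,j} and L̃_{m+1,j} = l^{−1}_{m,j} − l^{−1}_{m+1,j}. Let f be C^{2p+1} and globally Lipschitz in its second argument, u the exact solution of u′ = f(t,u) with u(t_n) = u_n, and set t_{n,m} = t_n + (h/2)(s_m + 1). Suppose for each h > 0 the vectors U^0(h), …, U^K(h) satisfy: U^0_m = u_n + (t_{n,m} − t_n) f(t_n, u_n) (implicit Euler may equally be used), and for each k < K the implicit SDG equations U^{k+1}_0 = u_n + (h/2) ω_0 ( f(t_{n,0}, U^{k+1}_0) − f(t_{n,0}, U^k_0) ) + (h/2) ∑_{j=0}^{p} L̃_{0,j} ω_j f(t_{n,j}, U^k_j),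 and for 0 ≤ m ≤ p−1, U^{k+1}_{m+1} = U^{k+1}_m + (h/2) ω_{m+1} ( f(t_{n,m+1}, U^{k+1}_{m+1}) − f(t_{n,m+1}, U^k_{m+1}) ) + (h/2) ∑_{j=0}^{p} L̃_{m+1,j} ω_j f(t_{n,j}, U^k_j). Then there exist C > 0 and h_0 > 0 such that for all 0 < h ≤ h_0: |u(t_{n,m}) − U^K_m| ≤ C h^{min(p+2, K+2)} for 0 ≤ m ≤ p−1, and |u(t_n + h) − U^K_p| ≤ C h^{min(2p+2, K+2)}. -/
open Asymptotics Filter Topology in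
/-- Integrating `r = O(x ^ n)` from `0` gives `O(x ^ (n + 1))`. -/
theorem isBigO_pow_succ_of_hasDerivAt {R r : ℝ → ℝ} {n : ℕ} (hR : ∀ x, HasDerivAt R (r x) x)
    (h0 : R 0 = 0) (hr : r =O[𝓝 0] fun x => x ^ n) : R =O[𝓝 0] fun x => x ^ (n + 1) := by
  obtain ⟨C, hC, hr⟩ := hr.exists_nonneg
  obtain ⟨ε, hε, hball⟩ := Metric.eventually_nhds_iff_ball.1 hr.bound
  refine IsBigO.of_bound C (Metric.eventually_nhds_iff_ball.2 ⟨ε, hε, fun y hy => ?_⟩)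
  have h := (convex_closedBall (0 : ℝ) |y|).norm_image_sub_le_of_norm_hasDerivWithin_le
    (f := R) (f' := r) (C := C * |y| ^ n) (x := 0) (y := y)
    (fun x _ => (hR x).hasDerivWithinAt) (fun x hx => ?_) (by simp) (by simp)
  · simpa [h0, pow_succ, mul_assoc] using h
  · have hx' : |x| ≤ |y| := by simpa using hx
    have hy' : |y| < ε := by simpa using hy
    refine (hball x (by simpa using hx'.trans_lt hy')).trans ?_
    rw [norm_pow, Real.norm_eq_abs]
    gcongr

open Asymptotics Filter Topology in
/-- An antiderivative of an `n`-th order expansion is an `(n + 1)`-st order expansion. -/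
theorem isBigO_expansion_of_hasDerivAt {R r : ℝ → ℝ} {a : ℝ} {n : ℕ} {c : ℕ → ℝ}
    (hR : ∀ x, HasDerivAt R (r x) x)
    (hr : (fun y => r (a + y) - ∑ k ∈ Finset.range n, c k * y ^ k) =O[𝓝 0] fun y => y ^ n) :
    (fun y => R (a + y) - R a - ∑ k ∈ Finset.range n, c k * (y ^ (k + 1) / (k + 1)))
      =O[𝓝 0] fun y => y ^ (n + 1) := by
  refine isBigO_pow_succ_of_hasDerivAt (fun y => ?_) (by simp) hr
  refine (((hR (a + y)).comp_const_add a y).sub_const (R a)).sub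
    (HasDerivAt.fun_sum fun k _ => ?_)
  have h := ((hasDerivAt_pow (k + 1) y).div_const ((k : ℝ) + 1)).const_mul (c k)
  refine h.congr_deriv ?_
  have : (k : ℝ) + 1 ≠ 0 := by positivity
  push_cast
  rw [mul_div_cancel_left₀ _ this]

open Asymptotics Filter Topology in
theorem ContDiff.exists_isBigO_expansion {n : ℕ} {g : ℝ → ℝ} (hg : ContDiff ℝ n g) (a : ℝ) :
    ∃ c : ℕ → ℝ,
      (fun y => g (a + y) - ∑ k ∈ Finset.range n, c k * y ^ k) =O[𝓝 0] fun y => y ^ n := by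
  induction n generalizing g with
  | zero =>
    refine ⟨0, ?_⟩
    have : ContinuousAt (fun y => g (a + y)) 0 :=
      (hg.continuous.comp (continuous_const.add continuous_id)).continuousAt
    simpa using this.isBigO_one ℝ
  | succ n ih =>
    rw [Nat.cast_succ, contDiff_succ_iff_deriv] at hg
    obtain ⟨c, hc⟩ := ih hg.2.2
    refine ⟨fun k => if k = 0 then g a else c (k - 1) / k, ?_⟩
    refine (isBigO_expansion_of_hasDerivAt (fun x => (hg.1 x).hasDerivAt) hc).congr_left
      fun y => ?_
    rw [Finset.sum_range_succ']
    have : ∀ k ∈ Finset.range n, c k * (y ^ (k + 1) / (k + 1)) =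
        (if k + 1 = 0 then g a else c (k + 1 - 1) / ((k + 1 : ℕ) : ℝ)) * y ^ (k + 1) := by
      intro k _
      simp
      ring
    rw [Finset.sum_congr rfl this]
    simp
    ring

open Asymptotics Filter Topology in
/-- First order expansion with quadratic remainder, uniformly in the base point. -/
theorem ContDiff.isBigO_sub_sub_fderiv {E : Type*} [NormedAddCommGroup E] [NormedSpace ℝ E]
    {F : E → ℝ} (hF : ContDiff ℝ 2 F) (x₀ : E) :
    (fun z : E × E => F z.1 - F z.2 - fderiv ℝ F z.2 (z.1 - z.2))
      =O[𝓝 (x₀, x₀)] fun z => ‖z.1 - z.2‖ ^ 2 := by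
  have hd : Differentiable ℝ F := hF.differentiable (by norm_num)
  obtain ⟨Λ, s, hs, hΛ⟩ :=
    ((hF.fderiv_right (m := 1) (by norm_num)).contDiffAt (x := x₀)).exists_lipschitzOnWith
  obtain ⟨ε, hε, hball⟩ := Metric.mem_nhds_iff.1 hs
  refine IsBigO.of_bound Λ ?_
  filter_upwards [prod_mem_nhds (Metric.ball_mem_nhds x₀ hε) (Metric.ball_mem_nhds x₀ hε)]
    with z hz
  have hseg : segment ℝ z.2 z.1 ⊆ s := ((convex_ball x₀ ε).segment_subset hz.2 hz.1).trans hball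
  have h := (convex_segment z.2 z.1).norm_image_sub_le_of_norm_fderiv_le' (f := F)
    (𝕜 := ℝ) (φ := fderiv ℝ F z.2) (C := Λ * ‖z.1 - z.2‖) (fun x _ => hd x) (fun x hx => ?_)
    (left_mem_segment ℝ _ _) (right_mem_segment ℝ _ _)
  · simpa [sq, mul_assoc] using h
  · refine (hΛ.norm_sub_le (hseg hx) (hball hz.2)).trans ?_
    gcongr
    simpa [norm_sub_rev] using norm_sub_le_of_mem_segment hx

open Asymptotics Filter Topology in
theorem isBigO_mulVec {ι : Type*} [Fintype ι] {l : Filter ℝ} (M : Matrix ι ι ℝ)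
    (Z : ℝ → ι → ℝ) : (fun η => M.mulVec (Z η)) =O[l] Z :=
  (LinearMap.toContinuousLinearMap M.mulVecLin).isBigO_comp Z l

open Asymptotics Filter Topology in
theorem isBigO_smul_self {ι : Type*} [Fintype ι] {l : Filter ℝ} {Z X : ℝ → ι → ℝ} {n : ℕ}
    (hZ : Z =O[l] X) (hX : X =O[l] fun η => η ^ n) :
    (fun η => η • Z η) =O[l] fun η => η ^ (n + 1) := by
  simpa [pow_succ'] using (isBigO_refl (fun η : ℝ => η) l).smul (hZ.trans hX)

open Asymptotics Filter Topology in
/-- A term of size `O(η X)` can be absorbed into `X` as `η → 0`. -/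
theorem isBigO_of_eventuallyEq_add_smul {ι : Type*} [Fintype ι] {X Y Z : ℝ → ι → ℝ}
    (h : ∀ᶠ η in 𝓝[>] (0 : ℝ), X η = Y η + η • Z η) (hZ : Z =O[𝓝[>] 0] X) :
    X =O[𝓝[>] 0] Y := by
  have hη : (fun η : ℝ => η) =o[𝓝[>] 0] fun _ => (1 : ℝ) :=
    (isLittleO_one_iff ℝ).2 (tendsto_id.mono_left nhdsWithin_le_nhds)
  have h1 : (fun η => η • Z η) =o[𝓝[>] 0] X := by simpa using hη.smul_isBigO hZ
  refine h1.right_isBigO_sub.congr' EventuallyEq.rfl ?_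
  filter_upwards [h] with η hη
  rw [hη]
  simp

open Polynomial in
theorem Polynomial.sum_C_eval_mul_lagrange {p : ℕ} {s : Fin (p + 1) → ℝ}
    (hs : Function.Injective s) {ℓ : Fin (p + 1) → ℝ[X]} (hdeg : ∀ i, (ℓ i).natDegree ≤ p)
    (hval : ∀ i j, (ℓ i).eval (s j) = if i = j then 1 else 0) {G : ℝ[X]} (hG : G.natDegree ≤ p) :
    ∑ i, C (G.eval (s i)) * ℓ i = G := by
  have hlt : ∀ {q : ℝ[X]}, q.natDegree ≤ p → q.degree < (Finset.univ : Finset (Fin (p + 1))).card :=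
    fun hq => (degree_le_of_natDegree_le hq).trans_lt (by
      rw [Finset.card_univ, Fintype.card_fin]; exact_mod_cast p.lt_succ_self)
  refine eq_of_degrees_lt_of_eval_index_eq Finset.univ hs.injOn (hlt ?_) (hlt hG) fun j _ => ?_
  · exact natDegree_sum_le_of_forall_le _ _ fun i _ => (natDegree_C_mul_le _ _).trans (hdeg i)
  · simp [eval_finsetSum, hval]

open Polynomial in
theorem Polynomial.integral_eval_derivative (q : ℝ[X]) (a b : ℝ) :
    ∫ x in a..b, (derivative q).eval x = q.eval b - q.eval a :=
  intervalIntegral.integral_eq_sub_of_hasDerivAt (fun x _ => q.hasDerivAt x)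
    ((derivative q).continuous.intervalIntegrable a b)

/-- The order conditions `B(2p+1)`, `C(p+1)`, `D(p)` of a stiffly accurate `(p+1)`-stage
Runge-Kutta tableau on an interval of length `2`. -/
structure IsRadauTableau (p : ℕ) (x ω : Fin (p + 1) → ℝ)
    (A : Matrix (Fin (p + 1)) (Fin (p + 1)) ℝ) : Prop where
  last_node : x (Fin.last p) = 2
  last_row : ∀ j, A (Fin.last p) j = ω j
  weights : ∀ k ≤ 2 * p, ∑ j, ω j * x j ^ k = 2 ^ (k + 1) / (k + 1)
  stage : ∀ k ≤ p, ∀ m, ∑ j, A m j * x j ^ k = x m ^ (k + 1) / (k + 1)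
  adjoint : ∀ i < p, ∀ j,
    ∑ m, ω m * x m ^ i * A m j = ω j * ((2 ^ (i + 1) - x j ^ (i + 1)) / (i + 1))

open Polynomial in
theorem isRadauTableau_of_dg (p : ℕ) (s ω : Fin (p + 1) → ℝ)
    (hs : Function.Injective s) (hsp : s (Fin.last p) = 1)
    (hexact : ∀ q : ℝ[X], q.natDegree ≤ 2 * p →
      ∑ i, ω i * q.eval (s i) = ∫ x in (-1 : ℝ)..1, q.eval x)
    (ℓ : Fin (p + 1) → ℝ[X]) (hdeg : ∀ i, (ℓ i).natDegree ≤ p)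
    (hval : ∀ i j, (ℓ i).eval (s j) = if i = j then 1 else 0)
    (L : Matrix (Fin (p + 1)) (Fin (p + 1)) ℝ)
    (hLdef : ∀ i j, L i j =
      (∫ x in (-1 : ℝ)..1, (derivative (ℓ i)).eval x * (ℓ j).eval x)
        - (if i = Fin.last p then (1 : ℝ) else 0) * (if j = Fin.last p then (1 : ℝ) else 0))
    (hLinv : IsUnit L.det) :
    IsRadauTableau p (fun j => s j + 1) ω (-(L⁻¹ * Matrix.diagonal ω)) := by
  have hderiv : ∀ {q : ℝ[X]} {n : ℕ}, q.natDegree ≤ n → (derivative q).natDegree ≤ n - 1 :=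
    fun hq => (natDegree_derivative_le _).trans (Nat.sub_le_sub_right hq 1)
  have hL : ∀ i j, L i j = ω j * (derivative (ℓ i)).eval (s j)
      - (if i = Fin.last p then (1 : ℝ) else 0) * (if j = Fin.last p then (1 : ℝ) else 0) := by
    intro i j
    rw [hLdef]
    congr 1
    have h := hexact (derivative (ℓ i) * ℓ j)
      (natDegree_mul_le.trans (by have := hderiv (hdeg i); have := hdeg j; omega))
    simp only [eval_mul] at h
    rw [← h]
    simp [hval]
  have hleft : ∀ G : ℝ[X], G.natDegree ≤ p → ∀ j, ∑ i, G.eval (s i) * L i j =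
      ω j * (derivative G).eval (s j) - G.eval 1 * (if j = Fin.last p then (1 : ℝ) else 0) := by
    intro G hG j
    have hsum := sum_C_eval_mul_lagrange hs hdeg hval hG
    have h := congrArg (fun q => (derivative q).eval (s j)) hsum
    simp only [derivative_sum, derivative_C_mul, eval_finsetSum, eval_mul, eval_C] at h
    rw [← h]
    simp only [hL, mul_sub, Finset.sum_sub_distrib, Finset.mul_sum]
    congr 1
    · exact Finset.sum_congr rfl fun i _ => by ring
    · simp [hsp]
  have hright : ∀ Q : ℝ[X], Q.natDegree ≤ p + 1 → Q.eval (-1) = 0 → ∀ i,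
      ∑ j, L i j * Q.eval (s j) = -(ω i * (derivative Q).eval (s i)) := by
    intro Q hQ hQ0 i
    have h1 : ∑ j, ω j * (derivative (ℓ i) * Q).eval (s j)
        = ∫ x in (-1 : ℝ)..1, (derivative (ℓ i) * Q).eval x := by
      refine hexact _ ?_
      rcases Nat.eq_zero_or_pos p with rfl | hp
      · have : derivative (ℓ i) = 0 :=
          derivative_of_natDegree_zero (Nat.le_zero.1 (hdeg i))
        simp [this]
      · exact natDegree_mul_le.trans (by have := hderiv (hdeg i); omega)
    have h2 : ∑ j, ω j * (ℓ i * derivative Q).eval (s j)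
        = ∫ x in (-1 : ℝ)..1, (ℓ i * derivative Q).eval x :=
      hexact _ (natDegree_mul_le.trans (by have := hderiv hQ; have := hdeg i; omega))
    have h3 := integral_eval_derivative (ℓ i * Q) (-1) 1
    rw [derivative_mul] at h3
    simp only [eval_add] at h3
    rw [intervalIntegral.integral_add ((derivative (ℓ i) * Q).continuous.intervalIntegrable _ _)
      ((ℓ i * derivative Q).continuous.intervalIntegrable _ _), ← h1, ← h2] at h3
    have h4 : ∑ j, ω j * (ℓ i * derivative Q).eval (s j) = ω i * (derivative Q).eval (s i) := by
      simp [hval]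
    have h5 : (ℓ i).eval 1 = if i = Fin.last p then (1 : ℝ) else 0 := by
      have h := hval i (Fin.last p)
      rwa [hsp] at h
    rw [h4, eval_mul, eval_mul, hQ0, h5] at h3
    simp only [hL, sub_mul, Finset.sum_sub_distrib]
    have h6 : ∑ j, (if i = Fin.last p then (1 : ℝ) else 0) *
        (if j = Fin.last p then (1 : ℝ) else 0) * Q.eval (s j) =
        (if i = Fin.last p then (1 : ℝ) else 0) * Q.eval 1 := by
      simp [hsp]
    have h7 : ∑ j, ω j * (derivative (ℓ i)).eval (s j) * Q.eval (s j)
        = ∑ j, ω j * (derivative (ℓ i) * Q).eval (s j) :=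
      Finset.sum_congr rfl fun j _ => by rw [eval_mul]; ring
    rw [h6, h7]
    linarith
  set A := -(L⁻¹ * Matrix.diagonal ω) with hA
  have hLA : L * A = -Matrix.diagonal ω := by
    rw [hA, Matrix.mul_neg, Matrix.mul_nonsing_inv_cancel_left _ _ hLinv]
  have hAentry : ∀ m j, A m j = -(L⁻¹ m j * ω j) := fun m j => by simp [hA]
  have hstage : ∀ Q : ℝ[X], Q.natDegree ≤ p + 1 → Q.eval (-1) = 0 → ∀ m,
      ∑ j, A m j * (derivative Q).eval (s j) = Q.eval (s m) := by
    intro Q hQ hQ0 m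
    have h : L.mulVec (fun j => Q.eval (s j)) = fun i => -(ω i * (derivative Q).eval (s i)) :=
      funext fun i => hright Q hQ hQ0 i
    have h' := congrFun (congrArg (L⁻¹).mulVec h) m
    rw [Matrix.mulVec_mulVec, Matrix.nonsing_inv_mul _ hLinv, Matrix.one_mulVec] at h'
    rw [h']
    exact Finset.sum_congr rfl fun j _ => by rw [hAentry]; ring
  have hadj : ∀ G : ℝ[X], G.natDegree ≤ p → ∀ j,
      ∑ m, ω m * (derivative G).eval (s m) * A m j - G.eval 1 * A (Fin.last p) j
        = -(G.eval (s j) * ω j) := by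
    intro G hG j
    have h : Matrix.vecMul (fun i => G.eval (s i)) L = fun m =>
        ω m * (derivative G).eval (s m) - G.eval 1 * (if m = Fin.last p then (1 : ℝ) else 0) :=
      funext fun m => hleft G hG m
    have h' := congrFun (congrArg (fun v => Matrix.vecMul v A) h) j
    simp only [Matrix.vecMul_vecMul, hLA, Matrix.vecMul_neg, Pi.neg_apply,
      Matrix.vecMul_diagonal] at h'
    rw [h']
    simp [Matrix.vecMul, dotProduct, sub_mul, Finset.sum_sub_distrib]
  have hlast : ∀ j, A (Fin.last p) j = ω j := fun j => by
    have h := hadj 1 (by simp) j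
    simp at h
    linarith
  have hmono : ∀ k : ℕ, ((X + 1 : ℝ[X]) ^ k).natDegree = k := fun k => by
    rw [← C_1, natDegree_pow_X_add_C]
  have hmono' : ∀ (k : ℕ), derivative ((X + 1 : ℝ[X]) ^ (k + 1)) = C ((k : ℝ) + 1) * (X + 1) ^ k := by
    intro k
    simp [derivative_pow]
  refine ⟨by rw [hsp]; norm_num, hlast, fun k hk => ?_, fun k hk m => ?_, fun i hi j => ?_⟩
  · have hk' : (k : ℝ) + 1 ≠ 0 := by positivity
    have h := hexact ((X + 1) ^ k) ((hmono k).le.trans hk)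
    have h' := integral_eval_derivative ((X + 1 : ℝ[X]) ^ (k + 1)) (-1) 1
    simp only [hmono', eval_mul, eval_C, intervalIntegral.integral_const_mul] at h'
    rw [← h] at h'
    simp only [eval_pow, eval_add, eval_X, eval_one] at h'
    rw [eq_div_iff hk', mul_comm, h']
    norm_num
  · have hk' : (k : ℝ) + 1 ≠ 0 := by positivity
    have h := hstage ((X + 1) ^ (k + 1)) ((hmono _).le.trans (by omega)) (by simp) m
    simp only [hmono', eval_mul, eval_C, eval_pow, eval_add, eval_X, eval_one] at h
    rw [eq_div_iff hk', ← h, Finset.sum_mul]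
    exact Finset.sum_congr rfl fun j _ => by ring
  · have hi' : (i : ℝ) + 1 ≠ 0 := by positivity
    have h := hadj ((X + 1) ^ (i + 1)) ((hmono _).le.trans (by omega)) j
    simp only [hmono', eval_mul, eval_C, eval_pow, eval_add, eval_X, eval_one, hlast] at h
    rw [mul_div_assoc', eq_div_iff hi', Finset.sum_mul]
    have h2 : ∑ m, ω m * (s m + 1) ^ i * A m j * ((i : ℝ) + 1)
        = ∑ m, ω m * (((i : ℝ) + 1) * (s m + 1) ^ i) * A m j :=
      Finset.sum_congr rfl fun m _ => by ring
    rw [h2]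
    norm_num at h
    linarith

open Asymptotics Filter Topology in
theorem isBigO_pow_of_le {a b : ℕ} (h : b ≤ a) :
    (fun η : ℝ => η ^ a) =O[𝓝[>] 0] fun η => η ^ b := by
  refine IsBigO.of_bound 1 ?_
  filter_upwards [Ioo_mem_nhdsGT (zero_lt_one' ℝ)] with η hη
  rw [one_mul, norm_pow, norm_pow, Real.norm_of_nonneg hη.1.le]
  exact pow_le_pow_of_le_one hη.1.le hη.2.le h

open Asymptotics Filter Topology in
theorem Asymptotics.IsBigO.comp_mul_const_pow {φ : ℝ → ℝ} {n : ℕ}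
    (h : φ =O[𝓝 0] fun y => y ^ n) (x : ℝ) :
    (fun η => φ (η * x)) =O[𝓝[>] 0] fun η => η ^ n := by
  have ht : Tendsto (fun η : ℝ => η * x) (𝓝[>] 0) (𝓝 0) := by
    have : Tendsto (fun η : ℝ => η * x) (𝓝 0) (𝓝 (0 * x)) :=
      (continuous_id.mul continuous_const).tendsto 0
    rw [zero_mul] at this
    exact this.mono_left nhdsWithin_le_nhds
  refine (h.comp_tendsto ht).trans ?_
  refine IsBigO.of_bound (‖x ^ n‖) (Eventually.of_forall fun η => ?_)
  simp only [Function.comp_apply, mul_pow, norm_mul]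
  exact (mul_comm _ _).le

open Asymptotics Filter Topology in
/-- Expansion in the step size of the residual of the exact solution in the stage equations. -/
theorem exists_isBigO_residual_expansion {ι : Type*} [Fintype ι] {n : ℕ} {u g : ℝ → ℝ}
    (hu : ∀ t, HasDerivAt u (g t) t) (hg : ContDiff ℝ n g) (a : ℝ) (x : ι → ℝ)
    (A : Matrix ι ι ℝ) :
    ∃ c : ℕ → ℝ, ∀ m, (fun η => u (a + η * x m) - u a - η * ∑ j, A m j * g (a + η * x j)
      - ∑ k ∈ Finset.range n, c k * (x m ^ (k + 1) / (k + 1) - ∑ j, A m j * x j ^ k)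
          * η ^ (k + 1)) =O[𝓝[>] 0] fun η => η ^ (n + 1) := by
  obtain ⟨c, hc⟩ := hg.exists_isBigO_expansion a
  refine ⟨c, fun m => ?_⟩
  have h1 := (isBigO_expansion_of_hasDerivAt hu hc).comp_mul_const_pow (x m)
  have h2 : (fun η : ℝ => η * ∑ j, A m j * (g (a + η * x j)
      - ∑ k ∈ Finset.range n, c k * (η * x j) ^ k)) =O[𝓝[>] 0] fun η => η ^ (n + 1) := by
    simp only [pow_succ' _ n]
    exact (isBigO_refl _ _).mul
      (IsBigO.fun_sum fun j _ => (hc.comp_mul_const_pow (x j)).const_mul_left (A m j))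
  refine (h1.sub h2).congr_left fun η => ?_
  have h3 : ∑ j, A m j * (g (a + η * x j) - ∑ k ∈ Finset.range n, c k * (η * x j) ^ k)
      = ∑ j, A m j * g (a + η * x j)
        - ∑ k ∈ Finset.range n, c k * (∑ j, A m j * x j ^ k) * η ^ k := by
    simp only [mul_sub, Finset.sum_sub_distrib, Finset.mul_sum, Finset.sum_mul]
    rw [Finset.sum_comm]
    congr 1
    exact Finset.sum_congr rfl fun k _ => Finset.sum_congr rfl fun j _ => by ring
  rw [h3, mul_sub, Finset.mul_sum (Finset.range n)]
  simp only [mul_sub (c _), sub_mul, Finset.sum_sub_distrib]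
  have h4 : ∑ k ∈ Finset.range n, c k * ((η * x m) ^ (k + 1) / (k + 1))
      = ∑ k ∈ Finset.range n, c k * (x m ^ (k + 1) / (k + 1)) * η ^ (k + 1) :=
    Finset.sum_congr rfl fun k _ => by ring
  have h5 : ∑ k ∈ Finset.range n, η * (c k * (∑ j, A m j * x j ^ k) * η ^ k)
      = ∑ k ∈ Finset.range n, c k * (∑ j, A m j * x j ^ k) * η ^ (k + 1) :=
    Finset.sum_congr rfl fun k _ => by ring
  rw [h4, h5]
  ring

open Asymptotics Filter Topology in
theorem isBigO_sum_mul_pow_succ {n N : ℕ} (hN : N ≤ n + 1) {φ : ℝ → ℝ} {a : ℕ → ℝ}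
    (hφ : (fun η => φ η - ∑ k ∈ Finset.range n, a k * η ^ (k + 1))
      =O[𝓝[>] 0] fun η => η ^ (n + 1))
    (ha : ∀ k < n, k + 1 < N → a k = 0) : φ =O[𝓝[>] 0] fun η => η ^ N := by
  have h : (fun η : ℝ => ∑ k ∈ Finset.range n, a k * η ^ (k + 1))
      =O[𝓝[>] 0] fun η => η ^ N := by
    refine IsBigO.fun_sum fun k hk => ?_
    rcases lt_or_ge (k + 1) N with hkN | hkN
    · simp [ha k (Finset.mem_range.1 hk) hkN, isBigO_zero]
    · exact (isBigO_pow_of_le hkN).const_mul_left _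
  simpa using (hφ.trans (isBigO_pow_of_le hN)).add h

open Asymptotics Filter Topology in
/-- Stage order `p + 1`, order `2 p + 1` at the last node, and weak order conditions for the
residual of the exact solution in the equations of a Radau tableau. -/
theorem IsRadauTableau.isBigO_residual {p : ℕ} {x ω : Fin (p + 1) → ℝ}
    {A : Matrix (Fin (p + 1)) (Fin (p + 1)) ℝ} (hA : IsRadauTableau p x ω A) {u g : ℝ → ℝ}
    (hu : ∀ t, HasDerivAt u (g t) t) (hg : ContDiff ℝ (2 * p + 1 : ℕ) g) (a : ℝ)
    {d : ℝ → Fin (p + 1) → ℝ}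
    (hd : ∀ η m, d η m = u (a + η * x m) - u a - η * ∑ j, A m j * g (a + η * x j)) :
    d =O[𝓝[>] 0] (fun η => η ^ (p + 2)) ∧
    (fun η => d η (Fin.last p)) =O[𝓝[>] 0] (fun η => η ^ (2 * p + 2)) ∧
    ∀ i < p, (fun η => ∑ m, ω m * x m ^ i * d η m) =O[𝓝[>] 0]
      fun η => η ^ (2 * p + 1 - i) := by
  obtain ⟨c, hc⟩ := exists_isBigO_residual_expansion hu hg a x A
  simp only [← hd] at hc
  refine ⟨isBigO_pi.2 fun m => ?_, ?_, fun i hi => ?_⟩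
  · refine isBigO_sum_mul_pow_succ (by omega) (hc m) fun k _ hk => ?_
    rw [hA.stage k (by omega), sub_self, mul_zero]
  · refine isBigO_sum_mul_pow_succ (by omega) (hc (Fin.last p)) fun k hk _ => ?_
    simp only [hA.last_row, hA.last_node]
    rw [hA.weights k (by omega), sub_self, mul_zero]
  · have hsum : (fun η => ∑ m, ω m * x m ^ i * d η m - ∑ k ∈ Finset.range (2 * p + 1),
        (c k * ∑ m, ω m * x m ^ i * (x m ^ (k + 1) / (k + 1) - ∑ j, A m j * x j ^ k))
          * η ^ (k + 1)) =O[𝓝[>] 0] fun η => η ^ (2 * p + 1 + 1) := by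
      refine (IsBigO.fun_sum fun m (_ : m ∈ Finset.univ) =>
        (hc m).const_mul_left (ω m * x m ^ i)).congr_left fun η => ?_
      rw [Finset.sum_congr rfl fun m _ => mul_sub (ω m * x m ^ i) _ _, Finset.sum_sub_distrib]
      congr 1
      rw [Finset.sum_congr rfl fun m _ => Finset.mul_sum _ _ _, Finset.sum_comm]
      refine Finset.sum_congr rfl fun k _ => ?_
      rw [Finset.mul_sum, Finset.sum_mul]
      exact Finset.sum_congr rfl fun m _ => by ring
    refine isBigO_sum_mul_pow_succ (by omega) hsum fun k hk hk' => mul_eq_zero_of_right _ ?_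
    have h1 : ∑ m, ω m * x m ^ i * ∑ j, A m j * x j ^ k
        = ∑ j, ω j * ((2 ^ (i + 1) - x j ^ (i + 1)) / (i + 1)) * x j ^ k := by
      simp only [← hA.adjoint i hi, Finset.mul_sum, Finset.sum_mul]
      rw [Finset.sum_comm]
      exact Finset.sum_congr rfl fun k _ => Finset.sum_congr rfl fun m _ => by ring
    have h2 : ∑ j, ω j * ((2 ^ (i + 1) - x j ^ (i + 1)) / (i + 1)) * x j ^ k
        = (2 ^ (i + 1) * ∑ j, ω j * x j ^ k - ∑ j, ω j * x j ^ (i + k + 1)) / (i + 1) := by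
      rw [Finset.mul_sum, ← Finset.sum_sub_distrib, Finset.sum_div]
      exact Finset.sum_congr rfl fun j _ => by ring
    have h3 : ∑ m, ω m * x m ^ i * (x m ^ (k + 1) / (k + 1))
        = (∑ j, ω j * x j ^ (i + k + 1)) / (k + 1) := by
      rw [Finset.sum_div]
      exact Finset.sum_congr rfl fun j _ => by ring
    simp only [mul_sub, Finset.sum_sub_distrib]
    rw [h1, h2, h3, hA.weights k (by omega), hA.weights (i + k + 1) (by omega)]
    have hi' : (i : ℝ) + 1 ≠ 0 := by positivity
    have hk' : (k : ℝ) + 1 ≠ 0 := by positivity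
    have hik : (i : ℝ) + k + 1 + 1 ≠ 0 := by positivity
    push_cast
    field_simp
    ring

open Asymptotics Filter Topology in
/-- Superconvergence at the last node for the linearized error equation. -/
theorem IsRadauTableau.isBigO_last {p M : ℕ} {x ω : Fin (p + 1) → ℝ}
    {A : Matrix (Fin (p + 1)) (Fin (p + 1)) ℝ} (hA : IsRadauTableau p x ω A)
    (hM : p + 2 ≤ M) (hM' : M ≤ 2 * p + 2) {E d ρ D : ℝ → Fin (p + 1) → ℝ} {β : ℕ → ℝ}
    (hEq : ∀ᶠ η in 𝓝[>] (0 : ℝ), E η = d η - ρ η + η • A.mulVec (D η))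
    (hE : E =O[𝓝[>] 0] fun η => η ^ (p + 2))
    (hdlast : (fun η => d η (Fin.last p)) =O[𝓝[>] 0] (fun η => η ^ (2 * p + 2)))
    (hdweak : ∀ i < p, (fun η => ∑ m, ω m * x m ^ i * d η m) =O[𝓝[>] 0]
      fun η => η ^ (2 * p + 1 - i))
    (hρ : ρ =O[𝓝[>] 0] fun η => η ^ M)
    (hD : ∀ j, (fun η => D η j - (∑ l ∈ Finset.range p, β l * (η * x j) ^ l) * E η j)
      =O[𝓝[>] 0] fun η => η ^ (2 * p + 2)) :
    (fun η => E η (Fin.last p)) =O[𝓝[>] 0] fun η => η ^ M := by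
  have hT : ∀ r m : ℕ, p ≤ m → m ≤ 2 * p + 2 →
      (∀ l < p, (fun η => ∑ j, ω j * x j ^ (l + r) * E η j) =O[𝓝[>] 0] fun η => η ^ (m - l)) →
      (fun η => ∑ j, ω j * x j ^ r * D η j) =O[𝓝[>] 0] fun η => η ^ m := by
    intro r m hpm hm hS
    have h1 : (fun η => ∑ j, ω j * x j ^ r *
        (D η j - (∑ l ∈ Finset.range p, β l * (η * x j) ^ l) * E η j))
        =O[𝓝[>] 0] fun η => η ^ m :=
      IsBigO.fun_sum fun j _ => ((hD j).trans (isBigO_pow_of_le hm)).const_mul_left _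
    have h2 : (fun η => ∑ l ∈ Finset.range p, β l *
        (η ^ l * ∑ j, ω j * x j ^ (l + r) * E η j)) =O[𝓝[>] 0] fun η => η ^ m := by
      refine IsBigO.fun_sum fun l hl => IsBigO.const_mul_left ?_ _
      have hl := Finset.mem_range.1 hl
      refine ((isBigO_refl (fun η : ℝ => η ^ l) _).mul (hS l hl)).congr_right fun η => ?_
      rw [← pow_add, Nat.add_sub_cancel' (hl.le.trans hpm)]
    refine (h1.add h2).congr_left fun η => ?_
    simp only [mul_sub, Finset.sum_sub_distrib, Finset.mul_sum, Finset.sum_mul]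
    rw [Finset.sum_comm, sub_add_eq_add_sub, sub_eq_iff_eq_add]
    congr 1
    exact Finset.sum_congr rfl fun l _ => Finset.sum_congr rfl fun j _ => by ring
  have hS : ∀ m i : ℕ, m + i ≤ 2 * p + 1 → m ≤ M →
      (fun η => ∑ j, ω j * x j ^ i * E η j) =O[𝓝[>] 0] fun η => η ^ m := by
    intro m
    induction m using Nat.strong_induction_on with
    | _ m ih =>
      intro i him hmM
      rcases le_or_gt m (p + 2) with hmp | hmp
      · exact IsBigO.fun_sum fun j _ =>
          ((isBigO_pi.1 hE j).trans (isBigO_pow_of_le hmp)).const_mul_left _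
      have hi : i < p := by omega
      have hTr : ∀ r ≤ i + 1, (fun η => ∑ j, ω j * x j ^ r * D η j)
          =O[𝓝[>] 0] fun η => η ^ (m - 1) := fun r hr =>
        hT r (m - 1) (by omega) (by omega) fun l hl =>
          ih (m - 1 - l) (by omega) (l + r) (by omega) (by omega)
      have h1 := (hdweak i hi).trans (isBigO_pow_of_le (show m ≤ 2 * p + 1 - i by omega))
      have h2 : (fun η => ∑ j, ω j * x j ^ i * ρ η j) =O[𝓝[>] 0] fun η => η ^ m :=
        IsBigO.fun_sum fun j _ =>
          ((isBigO_pi.1 hρ j).trans (isBigO_pow_of_le hmM)).const_mul_left _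
      have h3 := (isBigO_refl (fun η : ℝ => η) (𝓝[>] 0)).mul
        ((((hTr 0 (by omega)).const_mul_left (2 ^ (i + 1))).sub
          (hTr (i + 1) le_rfl)).const_mul_left ((i : ℝ) + 1)⁻¹)
      have hpow : ∀ η : ℝ, η * η ^ (m - 1) = η ^ m := fun η => by
        rw [← pow_succ', Nat.sub_add_cancel (by omega)]
      simp only [hpow] at h3
      refine ((h1.sub h2).add h3).congr' ?_ EventuallyEq.rfl
      filter_upwards [hEq] with η hη
      have h4 : ∑ j, ω j * x j ^ i * (A.mulVec (D η)) j
          = ∑ j, ω j * ((2 ^ (i + 1) - x j ^ (i + 1)) / (i + 1)) * D η j := by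
        simp only [← hA.adjoint i hi, Matrix.mulVec, dotProduct, Finset.mul_sum, Finset.sum_mul]
        rw [Finset.sum_comm]
        exact Finset.sum_congr rfl fun k _ => Finset.sum_congr rfl fun m _ => by ring
      have h5 : ∑ j, ω j * ((2 ^ (i + 1) - x j ^ (i + 1)) / (i + 1)) * D η j
          = ((i : ℝ) + 1)⁻¹ * (2 ^ (i + 1) * ∑ j, ω j * x j ^ 0 * D η j
            - ∑ j, ω j * x j ^ (i + 1) * D η j) := by
        rw [Finset.mul_sum, ← Finset.sum_sub_distrib, Finset.mul_sum]
        exact Finset.sum_congr rfl fun j _ => by ring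
      rw [← h5, ← h4, Finset.mul_sum, ← Finset.sum_sub_distrib, ← Finset.sum_add_distrib]
      refine Finset.sum_congr rfl fun j _ => ?_
      rw [hη]
      simp only [Pi.add_apply, Pi.sub_apply, Pi.smul_apply, smul_eq_mul]
      ring
  have hT0 := (isBigO_refl (fun η : ℝ => η) (𝓝[>] 0)).mul
    (hT 0 (M - 1) (by omega) (by omega) fun l hl => hS (M - 1 - l) (l + 0) (by omega) (by omega))
  have hpow : ∀ η : ℝ, η * η ^ (M - 1) = η ^ M := fun η => by
    rw [← pow_succ', Nat.sub_add_cancel (by omega)]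
  simp only [hpow] at hT0
  refine (((hdlast.trans (isBigO_pow_of_le hM')).sub (isBigO_pi.1 hρ (Fin.last p))).add hT0).congr' ?_
    EventuallyEq.rfl
  filter_upwards [hEq] with η hη
  rw [hη]
  simp [Matrix.mulVec, dotProduct, hA.last_row]

open Asymptotics Filter Topology in
/-- Each sweep of the deferred correction iteration gains one order in the defect. -/
theorem isBigO_sweep_defect {ι : Type*} [Fintype ι] {A T : Matrix ι ι ℝ}
    {F : ℝ → (ι → ℝ) → ι → ℝ} {V : ℕ → ℝ → ι → ℝ} {c : ι → ℝ} {K : ℕ}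
    (hF : ∀ X Y : ℝ → ι → ℝ,
      (fun η => F η (X η) - F η (Y η)) =O[𝓝[>] 0] fun η => X η - Y η)
    (h0 : (fun η => V 0 η - (c + η • A.mulVec (F η (V 0 η)))) =O[𝓝[>] 0] fun η => η ^ 2)
    (hV : ∀ k < K, ∀ᶠ η in 𝓝[>] (0 : ℝ), V (k + 1) η = c + η • A.mulVec (F η (V k η))
      + η • T.mulVec (F η (V (k + 1) η) - F η (V k η))) :
    ∀ k ≤ K, (fun η => V k η - (c + η • A.mulVec (F η (V k η))))
      =O[𝓝[>] 0] fun η => η ^ (k + 2) := by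
  intro k hk
  induction k with
  | zero => exact h0
  | succ k ih =>
    have ih := ih (by omega)
    have hV := hV k hk
    have hstep : (fun η => V (k + 1) η - V k η) =O[𝓝[>] 0] fun η => η ^ (k + 2) := by
      refine (isBigO_of_eventuallyEq_add_smul
        (Y := fun η => -(V k η - (c + η • A.mulVec (F η (V k η)))))
        (Z := fun η => T.mulVec (F η (V (k + 1) η) - F η (V k η))) ?_ ?_).trans ih.neg_left
      · filter_upwards [hV] with η hη
        nth_rewrite 1 [hη]
        abel
      · exact (isBigO_mulVec T _).trans (hF _ _)
    refine (isBigO_smul_self ((isBigO_mulVec (T - A) fun η =>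
      F η (V (k + 1) η) - F η (V k η)).trans (hF _ _)) hstep).congr' ?_ EventuallyEq.rfl
    filter_upwards [hV] with η hη
    rw [eq_sub_iff_add_eq]
    refine Eq.trans ?_ hη.symm
    rw [Matrix.sub_mulVec, Matrix.mulVec_sub A, smul_sub, smul_sub]
    abel

theorem contDiff_of_hasDerivAt_ode {f : ℝ → ℝ → ℝ} {u : ℝ → ℝ} {n : ℕ}
    (hf : ContDiff ℝ n (Function.uncurry f)) (hu : ∀ t, HasDerivAt u (f t (u t)) t) :
    ContDiff ℝ n u := by
  have key : ∀ m ≤ n, ContDiff ℝ m u := by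
    intro m hm
    induction m with
    | zero =>
      exact contDiff_zero.2 (continuous_iff_continuousAt.2 fun t => (hu t).continuousAt)
    | succ m ih =>
      rw [Nat.cast_succ, contDiff_succ_iff_deriv]
      refine ⟨fun t => (hu t).differentiableAt, fun h => absurd h (by simp), ?_⟩
      have hd : deriv u = Function.uncurry f ∘ fun t => (t, u t) :=
        funext fun t => (hu t).deriv
      rw [hd]
      exact (hf.of_le (by exact_mod_cast (by omega : m ≤ n))).comp
        (contDiff_id.prodMk (ih (by omega)))
  exact key n le_rfl

open Asymptotics Filter Topology in
/-- Linearization along an exact solution, with the linear coefficient expanded in time. -/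
theorem exists_isBigO_linearization {ι : Type*} [Fintype ι] {p : ℕ} {f : ℝ → ℝ → ℝ} {u : ℝ → ℝ}
    (hf : ContDiff ℝ 2 (Function.uncurry f)) (hf' : ContDiff ℝ (p + 1 : ℕ) (Function.uncurry f))
    (hu : ContDiff ℝ p u) (a : ℝ) (x : ι → ℝ) {V : ℝ → ι → ℝ}
    (hE : (fun η j => u (a + η * x j) - V η j) =O[𝓝[>] 0] fun η => η ^ (p + 2)) :
    ∃ β : ℕ → ℝ, ∀ j, (fun η => f (a + η * x j) (u (a + η * x j)) - f (a + η * x j) (V η j)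
      - (∑ l ∈ Finset.range p, β l * (η * x j) ^ l) * (u (a + η * x j) - V η j))
      =O[𝓝[>] 0] fun η => η ^ (2 * p + 2) := by
  let b : ℝ → ℝ := fun t => fderiv ℝ (Function.uncurry f) (t, u t) (0, 1)
  have hb : ContDiff ℝ p b :=
    ((hf'.fderiv_right (m := p) (by norm_cast)).comp (contDiff_id.prodMk hu)).clm_apply
      contDiff_const
  obtain ⟨β, hβ⟩ := hb.exists_isBigO_expansion a
  refine ⟨β, fun j => ?_⟩
  have hEj := isBigO_pi.1 hE j
  have hη : Tendsto (fun η : ℝ => η) (𝓝[>] 0) (𝓝 0) := tendsto_id.mono_left nhdsWithin_le_nhds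
  have ht : Tendsto (fun η => a + η * x j) (𝓝[>] 0) (𝓝 a) := by
    simpa using (hη.mul_const (x j)).const_add a
  have hut : Tendsto (fun η => u (a + η * x j)) (𝓝[>] 0) (𝓝 (u a)) :=
    (hu.continuous.tendsto a).comp ht
  have hE0 : Tendsto (fun η => u (a + η * x j) - V η j) (𝓝[>] 0) (𝓝 0) :=
    hEj.trans_tendsto (by simpa using hη.pow (p + 2))
  have hVt : Tendsto (fun η => V η j) (𝓝[>] 0) (𝓝 (u a)) := by
    simpa using hut.sub hE0
  have hquad := (hf.isBigO_sub_sub_fderiv (a, u a)).comp_tendsto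
    ((ht.prodMk_nhds hVt).prodMk_nhds (ht.prodMk_nhds hut))
  have hquad' : (fun η => f (a + η * x j) (u (a + η * x j)) - f (a + η * x j) (V η j)
      - b (a + η * x j) * (u (a + η * x j) - V η j)) =O[𝓝[>] 0] fun η => η ^ (2 * p + 2) := by
    refine IsBigO.trans (IsBigO.congr_left (f₁ := _) (IsBigO.neg_left hquad) fun η => ?_)
      ((IsBigO.of_bound 1 (Eventually.of_forall fun η => ?_)).trans
        ((hEj.pow 2).trans ((isBigO_pow_of_le (show 2 * p + 2 ≤ (p + 2) * 2 by omega)).congr_left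
          fun η => pow_mul η _ _)))
    · have hsub : (a + η * x j, V η j) - (a + η * x j, u (a + η * x j))
          = (V η j - u (a + η * x j)) • ((0, 1) : ℝ × ℝ) := by simp
      simp only [Function.comp_apply]
      rw [hsub, map_smul]
      simp only [Function.uncurry_apply_pair, smul_eq_mul, b]
      ring
    · simp [Prod.norm_def, abs_sub_comm]
  have hlin := ((hβ.comp_mul_const_pow (x j)).mul hEj)
  have hlin' := hlin.trans ((isBigO_pow_of_le (show 2 * p + 2 ≤ p + (p + 2) by omega)).congr_left
    fun η => pow_add η _ _)
  refine (hquad'.add hlin').congr_left fun η => ?_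
  ring

open Asymptotics Filter Topology in
theorem IsRadauTableau.isBigO_error {p N : ℕ} {x ω : Fin (p + 1) → ℝ}
    {A : Matrix (Fin (p + 1)) (Fin (p + 1)) ℝ} (hA : IsRadauTableau p x ω A)
    {f : ℝ → ℝ → ℝ} {Λ : NNReal} (hf : ContDiff ℝ (2 * p + 1 : ℕ) (Function.uncurry f))
    (hLip : ∀ t, LipschitzWith Λ (f t)) {u : ℝ → ℝ} (hu : ∀ t, HasDerivAt u (f t (u t)) t)
    (a : ℝ) {V : ℝ → Fin (p + 1) → ℝ}
    (hV : (fun η => V η - ((fun _ => u a)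
      + η • A.mulVec fun j => f (a + η * x j) (V η j))) =O[𝓝[>] 0] fun η => η ^ N) :
    (fun η j => u (a + η * x j) - V η j) =O[𝓝[>] 0] (fun η => η ^ min (p + 2) N) ∧
    (fun η => u (a + η * x (Fin.last p)) - V η (Fin.last p)) =O[𝓝[>] 0]
      fun η => η ^ min (2 * p + 2) N := by
  have hudiff := contDiff_of_hasDerivAt_ode hf hu
  have hg : ContDiff ℝ (2 * p + 1 : ℕ) fun t => f t (u t) :=
    hf.comp (contDiff_id.prodMk hudiff)
  set d : ℝ → Fin (p + 1) → ℝ := fun η m => u (a + η * x m) - u a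
    - η * ∑ j, A m j * f (a + η * x j) (u (a + η * x j)) with hd
  set ρ : ℝ → Fin (p + 1) → ℝ := fun η => V η - ((fun _ => u a)
      + η • A.mulVec fun j => f (a + η * x j) (V η j)) with hρ
  set D : ℝ → Fin (p + 1) → ℝ := fun η j =>
    f (a + η * x j) (u (a + η * x j)) - f (a + η * x j) (V η j) with hDdef
  set E : ℝ → Fin (p + 1) → ℝ := fun η j => u (a + η * x j) - V η j with hEdef
  have hEq : ∀ η, E η = d η - ρ η + η • A.mulVec (D η) := by
    intro η
    ext m
    simp only [hEdef, hd, hρ, hDdef, Pi.add_apply, Pi.sub_apply, Pi.smul_apply, smul_eq_mul,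
      Matrix.mulVec, dotProduct, mul_sub, Finset.sum_sub_distrib]
    ring
  obtain ⟨hdstage, hdlast, hdweak⟩ := hA.isBigO_residual hu hg a (d := d) fun _ _ => rfl
  have hD : D =O[𝓝[>] 0] E := isBigO_pi.2 fun j =>
    (IsBigO.of_bound Λ (Eventually.of_forall fun η => (hLip _).norm_sub_le _ _)).trans
      (isBigO_pi.1 (isBigO_refl E (𝓝[>] 0)) j)
  have hE : E =O[𝓝[>] 0] fun η => η ^ min (p + 2) N :=
    (isBigO_of_eventuallyEq_add_smul (Eventually.of_forall hEq)
      ((isBigO_mulVec A D).trans hD)).trans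
      ((hdstage.trans (isBigO_pow_of_le (min_le_left _ _))).sub
        (hV.trans (isBigO_pow_of_le (min_le_right _ _))))
  refine ⟨hE, ?_⟩
  rcases le_or_gt (min (2 * p + 2) N) (p + 2) with hM | hM
  · exact (isBigO_pi.1 hE (Fin.last p)).trans (isBigO_pow_of_le (by omega))
  · have hp : 1 ≤ p := by omega
    have hE' : E =O[𝓝[>] 0] fun η => η ^ (p + 2) := hE.trans (isBigO_pow_of_le (by omega))
    have hf2 : ContDiff ℝ 2 (Function.uncurry f) :=
      hf.of_le (by exact_mod_cast (by omega : 2 ≤ 2 * p + 1))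
    have hfp : ContDiff ℝ (p + 1 : ℕ) (Function.uncurry f) :=
      hf.of_le (by exact_mod_cast (by omega : p + 1 ≤ 2 * p + 1))
    have hup : ContDiff ℝ p u :=
      hudiff.of_le (by exact_mod_cast (by omega : p ≤ 2 * p + 1))
    obtain ⟨β, hβ⟩ := exists_isBigO_linearization hf2 hfp hup a x hE'
    exact hA.isBigO_last hM.le (min_le_left _ _) (Eventually.of_forall hEq) hE' hdlast hdweak
      (hV.trans (isBigO_pow_of_le (min_le_right _ _))) hβ

/-- Summing the node-to-node increments of a sweep. -/
theorem sweep_telescope {p : ℕ} {ω U G δ : Fin (p + 1) → ℝ} {c η : ℝ}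
    {A Ltil : Matrix (Fin (p + 1)) (Fin (p + 1)) ℝ} (h0 : ∀ j, Ltil 0 j * ω j = A 0 j)
    (hS : ∀ (m : Fin p) j, Ltil m.succ j * ω j = A m.succ j - A m.castSucc j)
    (hU0 : U 0 = c + η * ω 0 * δ 0 + η * ∑ j, Ltil 0 j * ω j * G j)
    (hUS : ∀ m : Fin p, U m.succ = U m.castSucc + η * ω m.succ * δ m.succ
      + η * ∑ j, Ltil m.succ j * ω j * G j) (m : Fin (p + 1)) :
    U m = c + η * ∑ j, A m j * G j + η * ∑ i, (if i ≤ m then ω i else 0) * δ i := by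
  induction m using Fin.induction with
  | zero =>
    have hsum : ∑ i, (if i ≤ 0 then ω i else 0) * δ i = ω 0 * δ 0 := by
      simp
    rw [hU0, hsum]
    simp only [h0]
    ring
  | succ m ih =>
    have hsum : ∑ i, (if i ≤ m.succ then ω i else 0) * δ i
        = ∑ i, (if i ≤ m.castSucc then ω i else 0) * δ i + ω m.succ * δ m.succ := by
      have hlast : ω m.succ * δ m.succ = ∑ i, if i = m.succ then ω i * δ i else 0 := by simp
      rw [hlast, ← Finset.sum_add_distrib]
      refine Finset.sum_congr rfl fun i _ => ?_
      have hiff : i ≤ m.succ ↔ i ≤ m.castSucc ∨ i = m.succ := by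
        simp only [Fin.le_def, Fin.ext_iff, Fin.val_succ, Fin.val_castSucc]
        omega
      have hne : i ≤ m.castSucc → i ≠ m.succ := by
        simp only [Fin.le_def, ne_eq, Fin.ext_iff, Fin.val_succ, Fin.val_castSucc]
        omega
      by_cases h1 : i ≤ m.castSucc
      · simp [hiff, h1, hne h1]
      · by_cases h2 : i = m.succ <;> simp [hiff, h1, h2]
    rw [hUS, ih, hsum]
    simp only [hS, sub_mul, Finset.sum_sub_distrib]
    ring

open Asymptotics Filter Topology in
/-- The Euler predictor has defect of second order. -/
theorem IsRadauTableau.isBigO_euler_defect {p : ℕ} {x ω : Fin (p + 1) → ℝ}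
    {A : Matrix (Fin (p + 1)) (Fin (p + 1)) ℝ} (hA : IsRadauTableau p x ω A)
    {f : ℝ → ℝ → ℝ} (hf : Differentiable ℝ (Function.uncurry f)) (a c : ℝ)
    {V : ℝ → Fin (p + 1) → ℝ} (hV : ∀ᶠ η in 𝓝[>] (0 : ℝ), ∀ m, V η m = c + η * x m * f a c) :
    (fun η => V η - ((fun _ => c) + η • A.mulVec fun j => f (a + η * x j) (V η j)))
      =O[𝓝[>] 0] fun η => η ^ 2 := by
  have hZ : (fun η j => f a c - f (a + η * x j) (c + η * x j * f a c))
      =O[𝓝[>] 0] fun η : ℝ => η ^ 1 := by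
    refine isBigO_pi.2 fun j => ?_
    have hd : Differentiable ℝ
        fun η : ℝ => Function.uncurry f (a + η * x j, c + η * x j * f a c) :=
      hf.comp (by fun_prop)
    have h := (hd 0).isBigO_sub.neg_left.mono (nhdsWithin_le_nhds (s := Set.Ioi 0))
    simpa [Function.uncurry] using h
  refine (isBigO_smul_self (isBigO_mulVec A _) hZ).congr' ?_ EventuallyEq.rfl
  filter_upwards [hV] with η hη
  ext m
  have hrow : ∑ j, A m j * f a c = x m * f a c := by
    rw [← Finset.sum_mul]
    have h := hA.stage 0 (Nat.zero_le _) m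
    simp at h
    rw [h]
  simp only [Pi.sub_apply, Pi.add_apply, Pi.smul_apply, smul_eq_mul, Matrix.mulVec, dotProduct,
    hη, mul_sub, Finset.sum_sub_distrib, hrow]
  ring

open Asymptotics Filter Topology in
theorem Asymptotics.IsBigO.exists_bound_halved {φ : ℝ → ℝ} {n : ℕ}
    (h : φ =O[𝓝[>] 0] fun η => η ^ n) :
    ∃ C : ℝ, ∀ᶠ h in 𝓝[>] (0 : ℝ), |φ (h / 2)| ≤ C * h ^ n := by
  obtain ⟨C, hC, hb⟩ := h.exists_nonneg
  have ht : Tendsto (fun h : ℝ => h / 2) (𝓝[>] 0) (𝓝[>] 0) := by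
    refine tendsto_nhdsWithin_iff.2 ⟨?_, ?_⟩
    · have : Tendsto (fun h : ℝ => h / 2) (𝓝 0) (𝓝 (0 / 2)) :=
        (continuous_id.div_const 2).tendsto 0
      rw [zero_div] at this
      exact this.mono_left nhdsWithin_le_nhds
    · filter_upwards [self_mem_nhdsWithin] with h hh
      exact half_pos (Set.mem_Ioi.1 hh)
  refine ⟨C, ?_⟩
  filter_upwards [ht.eventually hb.bound, self_mem_nhdsWithin] with h hh hpos
  have hpos : 0 < h := hpos
  refine hh.trans ?_
  rw [norm_pow, Real.norm_of_nonneg (half_pos hpos).le]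
  gcongr
  exact half_le_self hpos.le


open Asymptotics Filter Topology in
/-- Local truncation error of the implicit SDG scheme. With `L̃` built from
the rows of `L⁻¹`, initialization `U⁰_m = u_n + (t_{n,m} - t_n) f(t_n, u_n)`, and vectors
`U⁰(h), …, U^K(h)` satisfying the implicit SDG equations for every `k < K`, there are
`C > 0`, `h₀ > 0` such that for `0 < h ≤ h₀`:
`|u(t_{n,m}) - U^K_m| ≤ C h^{min(p+2, K+2)}` for `0 ≤ m ≤ p-1` and
`|u(t_n + h) - U^K_p| ≤ C h^{min(2p+2, K+2)}`. -/
theorem sdg_implicit_local_truncation_error (p : ℕ) (s ω : Fin (p + 1) → ℝ)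
    (hs : StrictMono s) (hs0 : (-1 : ℝ) < s 0) (hsp : s (Fin.last p) = 1)
    (hω : ∀ i, 0 < ω i)
    (hexact : ∀ q : Polynomial ℝ, q.natDegree ≤ 2 * p →
      ∑ i, ω i * q.eval (s i) = ∫ x in (-1:ℝ)..1, q.eval x)
    (ℓ : Fin (p + 1) → Polynomial ℝ)
    (hdeg : ∀ i, (ℓ i).natDegree ≤ p)
    (hval : ∀ i j, (ℓ i).eval (s j) = if i = j then 1 else 0)
    (L : Matrix (Fin (p + 1)) (Fin (p + 1)) ℝ)
    (hLdef : ∀ i j, L i j =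
      (∫ x in (-1:ℝ)..1, (Polynomial.derivative (ℓ i)).eval x * (ℓ j).eval x)
        - (if i = Fin.last p then (1:ℝ) else 0) * (if j = Fin.last p then (1:ℝ) else 0))
    (hLinv : IsUnit L.det)
    (Ltil : Matrix (Fin (p + 1)) (Fin (p + 1)) ℝ)
    (hLtil0 : ∀ j, Ltil 0 j = -(L⁻¹ 0 j))
    (hLtilS : ∀ (m : Fin p) (j : Fin (p + 1)),
      Ltil m.succ j = L⁻¹ m.castSucc j - L⁻¹ m.succ j)
    (f : ℝ → ℝ → ℝ) (Λ : NNReal)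
    (hf : ContDiff ℝ (2 * p + 1) (Function.uncurry f))
    (hLip : ∀ t, LipschitzWith Λ (f t))
    (u : ℝ → ℝ) (hu : ∀ t, HasDerivAt u (f t (u t)) t)
    (tn un : ℝ) (hun : u tn = un)
    (K : ℕ)
    (U : ℝ → ℕ → Fin (p + 1) → ℝ)
    (hU0 : ∀ h : ℝ, 0 < h → ∀ m, U h 0 m = un + (h / 2 * (s m + 1)) * f tn un)
    (hUk0 : ∀ h : ℝ, 0 < h → ∀ k < K, U h (k + 1) 0
      = un + h / 2 * ω 0 * (f (tn + h / 2 * (s 0 + 1)) (U h (k + 1) 0)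
            - f (tn + h / 2 * (s 0 + 1)) (U h k 0))
        + h / 2 * ∑ j, Ltil 0 j * ω j * f (tn + h / 2 * (s j + 1)) (U h k j))
    (hUkS : ∀ h : ℝ, 0 < h → ∀ k < K, ∀ m : Fin p, U h (k + 1) m.succ
      = U h (k + 1) m.castSucc
        + h / 2 * ω m.succ
          * (f (tn + h / 2 * (s m.succ + 1)) (U h (k + 1) m.succ)
            - f (tn + h / 2 * (s m.succ + 1)) (U h k m.succ))
        + h / 2 * ∑ j, Ltil m.succ j * ω j * f (tn + h / 2 * (s j + 1)) (U h k j)) :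
    ∃ C > 0, ∃ h₀ > 0, ∀ h : ℝ, 0 < h → h ≤ h₀ →
      (∀ m : Fin (p + 1), (m : ℕ) < p →
        |u (tn + h / 2 * (s m + 1)) - U h K m| ≤ C * h ^ (min (p + 2) (K + 2))) ∧
      |u (tn + h) - U h K (Fin.last p)| ≤ C * h ^ (min (2 * p + 2) (K + 2)) := by
  classical
  set x : Fin (p + 1) → ℝ := fun j => s j + 1 with hx
  set A : Matrix (Fin (p + 1)) (Fin (p + 1)) ℝ := -(L⁻¹ * Matrix.diagonal ω) with hAdef
  have hA : IsRadauTableau p x ω A :=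
    isRadauTableau_of_dg p s ω hs.injective hsp hexact ℓ hdeg hval L hLdef hLinv
  have hAentry : ∀ m j, A m j = -(L⁻¹ m j * ω j) := fun m j => by simp [hAdef]
  have hf' : ContDiff ℝ (2 * p + 1 : ℕ) (Function.uncurry f) := by exact_mod_cast hf
  let F : ℝ → (Fin (p + 1) → ℝ) → Fin (p + 1) → ℝ := fun η X j => f (tn + η * x j) (X j)
  let T : Matrix (Fin (p + 1)) (Fin (p + 1)) ℝ := fun m i => if i ≤ m then ω i else 0
  let V : ℕ → ℝ → Fin (p + 1) → ℝ := fun k η => U (2 * η) k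
  have hhalf : ∀ η : ℝ, 2 * η / 2 = η := fun η => mul_div_cancel_left₀ η two_ne_zero
  have hdefect := isBigO_sweep_defect (A := A) (T := T) (F := F) (V := V) (c := fun _ => u tn)
    (K := K) (fun X Y => isBigO_pi.2 fun j =>
      (IsBigO.of_bound Λ (Eventually.of_forall fun η => (hLip _).norm_sub_le _ _)).trans
        (isBigO_pi.1 (isBigO_refl (fun η => X η - Y η) (𝓝[>] 0)) j))
    (hA.isBigO_euler_defect (hf'.differentiable (by simp)) tn (u tn) (by
      filter_upwards [self_mem_nhdsWithin] with η hη m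
      have hη : 0 < η := hη
      simp only [V, hU0 (2 * η) (by positivity) m, hhalf, hun, hx]))
    (fun k hk => by
      filter_upwards [self_mem_nhdsWithin] with η hη
      have hη : 0 < η := hη
      have h0 := hUk0 (2 * η) (by positivity) k hk
      have hS := hUkS (2 * η) (by positivity) k hk
      simp only [hhalf] at h0 hS
      ext m
      have h := sweep_telescope (A := A) (Ltil := Ltil) (U := V (k + 1) η)
        (G := F η (V k η)) (δ := F η (V (k + 1) η) - F η (V k η))
        (fun j => by rw [hLtil0, hAentry]; ring)
        (fun m j => by rw [hLtilS, hAentry, hAentry]; ring) h0 hS m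
      rw [h, ← hun]
      simp [Matrix.mulVec, dotProduct, T]) K le_rfl
  obtain ⟨hstage, hlast⟩ := hA.isBigO_error hf' hLip hu tn hdefect
  obtain ⟨C₁, hC₁⟩ := (isBigO_norm_left.2 hstage).exists_bound_halved
  obtain ⟨C₂, hC₂⟩ := hlast.exists_bound_halved
  obtain ⟨ε, hε, hball⟩ := mem_nhdsGT_iff_exists_Ioc_subset.1 (hC₁.and hC₂)
  have htwo : ∀ h : ℝ, 2 * (h / 2) = h := fun h => mul_div_cancel₀ h two_ne_zero
  refine ⟨max (max C₁ C₂) 1, by positivity, ε, hε, fun h hpos hle => ?_⟩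
  obtain ⟨h₁, h₂⟩ := hball ⟨hpos, hle⟩
  refine ⟨fun m _ => ?_, ?_⟩
  · have hm := norm_le_pi_norm
      (fun j => u (tn + h / 2 * x j) - V K (h / 2) j) m
    simp only [V, htwo, Real.norm_eq_abs] at hm
    simp only [V, htwo, abs_norm] at h₁
    refine (hm.trans h₁).trans ?_
    gcongr
    exact (le_max_left _ _).trans (le_max_left _ _)
  · have hend : h / 2 * x (Fin.last p) = h := by
      rw [hA.last_node]
      ring
    simp only [V, htwo, hend] at h₂
    refine h₂.trans ?_
    gcongr
    exact (le_max_right _ _).trans (le_max_left _ _)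
end

section
/- (Global error of the SDG method.) Fix p ≥ 0 and K ≥ 0, and a quadrature rule on [−1,1] with nodes −1 < s_0 < ⋯ < s_p = 1 and positive weights ω_i exact for degree 2p; let ℓ_i be the Lagrange basis, L_{ij} = ∫_{−1}^{1} ℓ_i′ ℓ_j dt − δ_{ip} δ_{jp}, assume L invertible, and define L̃ by L̃_{0,j} = −l^{−1}_{0,j} and L̃_{m+1,j} = l^{−1}_{m,j} − l^{−1}_{m+1,j}. Let f be C^{2p+1} and globally Lipschitz in its second argument, let u solve u′ = f(t,u) on [0,T] with u(0) = u_0, and for N ≥ 1 set h = T/N, t_n = n h. Define numerical values u_0^N = u_0 and, for n = 0, …, N−1, u_{n+1}^N = U^K_p where the iterates on [t_n, t_{n+1}] are given by the explicit SDG scheme with inflow u_n^N: explicit Euler initialization U^0_m = u_n^N + (t_{n,m} − t_n) f(t_n, u_n^N) with t_{n,m} = t_n + (h/2)(s_m + 1), and updates U^{k+1}_0 = u_n^N + (h/2) ∑_j L̃_{0,j} ω_j f(t_{n,j}, U^k_j), U^{k+1}_{m+1} = U^{k+1}_m + (h/2) ω_m ( f(t_{n,m}, U^{k+1}_m) − f(t_{n,m},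 U^k_m) ) + (h/2) ∑_j L̃_{m+1,j} ω_j f(t_{n,j}, U^k_j). Then there exist C > 0 and N_0 such that for all N ≥ N_0, max_{0 ≤ n ≤ N} |u(t_n) − u_n^N| ≤ C h^{min(2p+1, K+1)}; i.e., the explicit SDG method with K iterations is a method of order min(2p+1, K+1). -/
open Set in
theorem exists_taylor_bound_of_deriv {T : ℝ} {m : ℕ} {g g' : ℝ → ℝ}
    (hg : ∀ t ∈ Icc 0 T, HasDerivWithinAt g (g' t) (Icc 0 T) t)
    (hg' : ∃ C : ℝ, 0 ≤ C ∧ ∀ t₀ ∈ Icc 0 T, ∃ c : ℕ → ℝ, (∀ k, |c k| ≤ C) ∧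
      ∀ t ∈ Icc 0 T, |g' t - ∑ k ∈ Finset.range m, c k * (t - t₀) ^ k| ≤ C * |t - t₀| ^ m) :
    ∃ C : ℝ, 0 ≤ C ∧ ∀ t₀ ∈ Icc 0 T, ∃ c : ℕ → ℝ, (∀ k, |c k| ≤ C) ∧ c 0 = g t₀ ∧
      (∀ t ∈ Icc 0 T,
        |g t - ∑ k ∈ Finset.range (m + 1), c k * (t - t₀) ^ k| ≤ C * |t - t₀| ^ (m + 1)) ∧
      ∀ t ∈ Icc 0 T, |g' t - ∑ k ∈ Finset.range m, (k + 1) * c (k + 1) * (t - t₀) ^ k|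
        ≤ C * |t - t₀| ^ m := by
  obtain ⟨C, hC, H⟩ := hg'
  have hcont : ContinuousOn g (Icc 0 T) := fun t ht => (hg t ht).continuousWithinAt
  obtain ⟨B, hB⟩ := isCompact_Icc.exists_bound_of_continuousOn hcont
  refine ⟨C + |B|, by positivity, fun t₀ ht₀ => ?_⟩
  obtain ⟨c, hc, hct⟩ := H t₀ ht₀
  have hCB : C ≤ C + |B| := by linarith [abs_nonneg B]
  have hco : ∀ k : ℕ, ((k : ℝ) + 1) * (c k / (k + 1)) = c k := fun k => by field_simp
  refine ⟨fun k => Nat.casesOn k (g t₀) (fun k => c k / (k + 1)), ?_, rfl, ?_, ?_⟩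
  · rintro (_ | k)
    · have := hB t₀ ht₀
      rw [Real.norm_eq_abs] at this
      change |g t₀| ≤ _
      linarith [le_abs_self B]
    · change |c k / (k + 1)| ≤ _
      rw [abs_div, abs_of_pos (by positivity : (0 : ℝ) < k + 1)]
      exact (div_le_self (abs_nonneg _) (by linarith [k.cast_nonneg (α := ℝ)])).trans
        ((hc k).trans hCB)
  · intro t ht
    have hsub : uIcc t₀ t ⊆ Icc 0 T := (ordConnected_Icc).uIcc_subset ht₀ ht
    have hder : ∀ x ∈ uIcc t₀ t, HasDerivWithinAt
        (fun x => g x - (g t₀ + ∑ k ∈ Finset.range m, c k / (k + 1) * (x - t₀) ^ (k + 1)))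
        (g' x - ∑ k ∈ Finset.range m, c k * (x - t₀) ^ k) (uIcc t₀ t) x := by
      intro x hx
      refine ((hg x (hsub hx)).mono hsub).sub (HasDerivAt.hasDerivWithinAt ?_)
      refine HasDerivAt.const_add _ (HasDerivAt.fun_sum fun k _ => ?_)
      have := ((((hasDerivAt_id x).sub_const t₀).pow (k + 1)).const_mul (c k / (k + 1)))
      refine this.congr_deriv ?_
      push_cast
      rw [mul_one, ← mul_assoc, mul_comm (c k / _), hco]
      rfl
    have hbd : ∀ x ∈ uIcc t₀ t, ‖g' x - ∑ k ∈ Finset.range m, c k * (x - t₀) ^ k‖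
        ≤ C * |t - t₀| ^ m := by
      intro x hx
      refine (hct x (hsub hx)).trans ?_
      have := abs_sub_left_of_mem_uIcc hx
      gcongr
    have key := (convex_uIcc t₀ t).norm_image_sub_le_of_norm_hasDerivWithin_le hder hbd
      left_mem_uIcc right_mem_uIcc
    simp only [sub_self, ne_eq, Nat.succ_ne_zero, not_false_eq_true, zero_pow, mul_zero,
      Finset.sum_const_zero, add_zero, sub_zero, Real.norm_eq_abs] at key
    rw [Finset.sum_range_succ']
    simp only [pow_zero, mul_one]
    change |g t - (_ + g t₀)| ≤ _
    rw [add_comm _ (g t₀)]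
    refine key.trans ?_
    rw [mul_assoc, ← pow_succ]
    gcongr
  · intro t ht
    simp only [hco]
    refine (hct t ht).trans ?_
    gcongr

open Set in
theorem ContDiffOn.exists_taylor_bound {T : ℝ} (hT : 0 < T) {m : ℕ} {g : ℝ → ℝ}
    (hg : ContDiffOn ℝ m g (Icc 0 T)) :
    ∃ C : ℝ, 0 ≤ C ∧ ∀ t₀ ∈ Icc 0 T, ∃ c : ℕ → ℝ, (∀ k, |c k| ≤ C) ∧
      ∀ t ∈ Icc 0 T, |g t - ∑ k ∈ Finset.range m, c k * (t - t₀) ^ k| ≤ C * |t - t₀| ^ m := by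
  induction m generalizing g with
  | zero =>
    obtain ⟨B, hB⟩ := isCompact_Icc.exists_bound_of_continuousOn hg.continuousOn
    refine ⟨|B|, abs_nonneg _, fun t₀ _ => ⟨0, by simp, fun t ht => ?_⟩⟩
    simpa using (hB t ht).trans (le_abs_self B)
  | succ m ih =>
    have hg' : ContDiffOn ℝ (m + 1) g (Icc 0 T) := by exact_mod_cast hg
    have h1 := (contDiffOn_succ_iff_derivWithin (uniqueDiffOn_Icc hT)).1 hg'
    obtain ⟨C, hC, H⟩ := exists_taylor_bound_of_deriv
      (fun t ht => (h1.1 t ht).hasDerivWithinAt) (ih h1.2.2)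
    exact ⟨C, hC, fun t₀ ht₀ => let ⟨c, hc, _, h, _⟩ := H t₀ ht₀; ⟨c, hc, h⟩⟩

open Set in
theorem contDiffOn_succ_of_hasDerivWithinAt_bootstrap {T : ℝ} (hT : 0 < T) {n : ℕ} {g g' : ℝ → ℝ}
    (hg : ∀ t ∈ Icc 0 T, HasDerivWithinAt g (g' t) (Icc 0 T) t)
    (hboot : ∀ m : ℕ, m ≤ n → ContDiffOn ℝ m g (Icc 0 T) → ContDiffOn ℝ m g' (Icc 0 T)) :
    ContDiffOn ℝ (n + 1 : ℕ) g (Icc 0 T) := by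
  have key : ∀ m : ℕ, m ≤ n + 1 → ContDiffOn ℝ m g (Icc 0 T) := by
    intro m
    induction m with
    | zero =>
      intro _
      exact_mod_cast contDiffOn_zero.2 fun t ht => (hg t ht).continuousWithinAt
    | succ m ih =>
      intro hm
      have h1 := hboot m (by omega) (ih (by omega))
      push_cast
      refine (contDiffOn_succ_iff_derivWithin (uniqueDiffOn_Icc hT)).2
        ⟨fun t ht => (hg t ht).differentiableWithinAt, by simp, h1.congr fun t ht => ?_⟩
      exact (hg t ht).derivWithin (uniqueDiffOn_Icc hT t ht)
  exact key _ le_rfl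

open Set in
theorem exists_dual_solution {T : ℝ} (hT : 0 < T) {n : ℕ} {a : ℝ → ℝ}
    (ha : ContDiffOn ℝ n a (Icc 0 T)) :
    ∃ ψ : ℝ → ℝ, (∀ t, 0 < ψ t) ∧ ContDiffOn ℝ (n + 1 : ℕ) ψ (Icc 0 T) ∧
      ∀ t ∈ Icc 0 T, HasDerivWithinAt ψ (-(a t * ψ t)) (Icc 0 T) t := by
  set b : ℝ → ℝ := IccExtend hT.le ((Icc 0 T).domRestrict a) with hb
  have hbc : Continuous b := ha.continuousOn.domRestrict.Icc_extend'
  have hba : ∀ t ∈ Icc 0 T, b t = a t := fun t ht => by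
    rw [hb, IccExtend_of_mem hT.le _ ht]; rfl
  set ψ : ℝ → ℝ := fun t => Real.exp (-∫ x in (0 : ℝ)..t, b x) with hψ
  have hd : ∀ t ∈ Icc 0 T, HasDerivWithinAt ψ (-(a t * ψ t)) (Icc 0 T) t := by
    intro t ht
    have h1 := (hbc.integral_hasStrictDerivAt 0 t).hasDerivAt.neg.exp.hasDerivWithinAt
      (s := Icc 0 T)
    rw [hba t ht] at h1
    refine h1.congr_deriv ?_
    rw [mul_neg, mul_comm]
    rfl
  refine ⟨ψ, fun t => Real.exp_pos _, ?_, hd⟩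
  exact contDiffOn_succ_of_hasDerivWithinAt_bootstrap hT hd fun m hm h =>
    ((ha.of_le (by exact_mod_cast hm)).mul h).neg

open Set in
theorem exists_quadratic_bound {f : ℝ → ℝ → ℝ} {Λ : NNReal}
    (hf : ContDiff ℝ 2 (Function.uncurry f)) (hLip : ∀ t, LipschitzWith Λ (f t)) {T : ℝ}
    {u : ℝ → ℝ} (hu : ContinuousOn u (Icc 0 T)) :
    ∃ C : ℝ, 0 ≤ C ∧ ∀ t ∈ Icc 0 T, ∀ y,
      |f t (u t) - f t y - fderiv ℝ (Function.uncurry f) (t, u t) (0, 1) * (u t - y)|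
        ≤ C * (u t - y) ^ 2 := by
  set F := Function.uncurry f with hF
  have hdiff : Differentiable ℝ F := hf.differentiable (by norm_num)
  have hD : ∀ t y, HasDerivAt (f t) (fderiv ℝ F (t, y) (0, 1)) y := by
    intro t y
    have h1 := (hdiff (t, y)).hasFDerivAt.comp_hasDerivAt y
      ((hasDerivAt_const y t).prodMk (hasDerivAt_id y))
    exact h1
  have hG : ContDiff ℝ 1 (fun z : ℝ × ℝ => fderiv ℝ F z (0, 1)) :=
    (hf.fderiv_right (m := 1) (by norm_num)).clm_apply contDiff_const
  set G := fun z : ℝ × ℝ => fderiv ℝ F z (0, 1) with hGdef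
  have hGd : ∀ t y, HasDerivAt (fun y => G (t, y)) (fderiv ℝ G (t, y) (0, 1)) y := by
    intro t y
    exact (hG.differentiable (by norm_num) (t, y)).hasFDerivAt.comp_hasDerivAt y
      ((hasDerivAt_const y t).prodMk (hasDerivAt_id y))
  have hGc : Continuous fun z : ℝ × ℝ => fderiv ℝ G z (0, 1) :=
    (hG.continuous_fderiv (by norm_num)).clm_apply continuous_const
  obtain ⟨B, hB⟩ := isCompact_Icc.exists_bound_of_continuousOn hu
  obtain ⟨M, hM⟩ := ((isCompact_Icc (a := (0 : ℝ)) (b := T)).prod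
    (isCompact_Icc (a := -B - 1) (b := B + 1))).exists_bound_of_continuousOn hGc.continuousOn
  refine ⟨|M| + 2 * Λ, by positivity, fun t ht y => ?_⟩
  have hub := abs_le.1 (hB t ht)
  have hΛ : |G (t, u t)| ≤ Λ := (hD t (u t)).le_of_lipschitz (hLip t)
  by_cases hy : |u t - y| ≤ 1
  · have hy' := abs_le.1 hy
    have hsub : ∀ x ∈ uIcc (u t) y, x ∈ Icc (-B - 1) (B + 1) := by
      intro x hx
      have hc : uIcc (u t) y ⊆ Icc (-B - 1) (B + 1) :=
        ordConnected_Icc.uIcc_subset ⟨by linarith, by linarith⟩ ⟨by linarith, by linarith⟩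
      exact hc hx
    have h1 : ∀ x ∈ uIcc (u t) y, ‖G (t, x) - G (t, u t)‖ ≤ |M| * |u t - y| := by
      intro x hx
      have h2 := (convex_uIcc (u t) y).norm_image_sub_le_of_norm_hasDerivWithin_le
        (fun z _ => (hGd t z).hasDerivWithinAt)
        (fun z hz => (hM (t, z) ⟨ht, hsub z hz⟩).trans (le_abs_self M)) left_mem_uIcc hx
      refine h2.trans ?_
      have := abs_sub_left_of_mem_uIcc hx
      rw [abs_sub_comm y] at this
      rw [Real.norm_eq_abs]
      gcongr
    have h3 := (convex_uIcc (u t) y).norm_image_sub_le_of_norm_hasDerivWithin_le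
      (f := fun x => f t x - G (t, u t) * x)
      (fun x _ => ((hD t x).sub ((hasDerivAt_id x).const_mul (G (t, u t)))).hasDerivWithinAt)
      (fun x hx => by simpa using h1 x hx) right_mem_uIcc left_mem_uIcc
    rw [Real.norm_eq_abs, Real.norm_eq_abs, mul_assoc, abs_mul_abs_self] at h3
    calc _ = |f t (u t) - G (t, u t) * u t - (f t y - G (t, u t) * y)| := by congr 1; ring
      _ ≤ _ := h3
      _ ≤ _ := by nlinarith [sq_nonneg (u t - y), Λ.coe_nonneg,
        mul_nonneg Λ.coe_nonneg (sq_nonneg (u t - y))]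
  · push Not at hy
    have h1 : |f t (u t) - f t y| ≤ Λ * |u t - y| := (hLip t).dist_le_mul (u t) y
    have h2 : |G (t, u t) * (u t - y)| ≤ Λ * |u t - y| := by rw [abs_mul]; gcongr
    have h3 : |u t - y| ≤ (u t - y) ^ 2 := by rw [← sq_abs]; nlinarith
    calc _ ≤ |f t (u t) - f t y| + |G (t, u t) * (u t - y)| := abs_sub _ _
      _ ≤ 2 * Λ * |u t - y| := by linarith
      _ ≤ (|M| + 2 * Λ) * (u t - y) ^ 2 := by
        gcongr
        linarith [abs_nonneg M]

open Polynomial in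
/-- A quadrature rule of `p + 1` nodes ending at `1` and exact in degree `2 * p`, with its Lagrange
basis `ℓ` and the matrix `L` of the discontinuous Galerkin time discretization. -/
structure SDGRule (p : ℕ) (s ω : Fin (p + 1) → ℝ) (ℓ : Fin (p + 1) → ℝ[X])
    (L : Matrix (Fin (p + 1)) (Fin (p + 1)) ℝ) : Prop where
  strictMono : StrictMono s
  neg_one_lt : -1 < s 0
  last : s (Fin.last p) = 1
  exact : ∀ q : ℝ[X], q.natDegree ≤ 2 * p → ∑ i, ω i * q.eval (s i) = ∫ x in (-1 : ℝ)..1, q.eval x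
  natDegree_le : ∀ i, (ℓ i).natDegree ≤ p
  eval_node : ∀ i j, (ℓ i).eval (s j) = if i = j then 1 else 0
  matrix_apply : ∀ i j, L i j = (∫ x in (-1 : ℝ)..1, (derivative (ℓ i)).eval x * (ℓ j).eval x)
    - (if i = Fin.last p then (1 : ℝ) else 0) * (if j = Fin.last p then (1 : ℝ) else 0)
  isUnit_det : IsUnit L.det

namespace SDGRule

open Polynomial Set

variable {p : ℕ} {s ω : Fin (p + 1) → ℝ} {ℓ : Fin (p + 1) → ℝ[X]}
  {L : Matrix (Fin (p + 1)) (Fin (p + 1)) ℝ}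

theorem sum_eval_derivative (R : SDGRule p s ω ℓ L) {g : ℝ[X]} (hg : g.natDegree ≤ 2 * p + 1) :
    ∑ i, ω i * (derivative g).eval (s i) = g.eval 1 - g.eval (-1) := by
  rw [R.exact _ ((natDegree_derivative_le g).trans (by omega))]
  exact intervalIntegral.integral_eq_sub_of_hasDerivAt (fun x _ => g.hasDerivAt x)
    ((derivative g).continuous.intervalIntegrable _ _)

theorem matrix_eq (R : SDGRule p s ω ℓ L) (i j : Fin (p + 1)) :
    L i j = ω j * (derivative (ℓ i)).eval (s j)
      - (ℓ i).eval 1 * (if j = Fin.last p then (1 : ℝ) else 0) := by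
  have hd : (derivative (ℓ i) * ℓ j).natDegree ≤ 2 * p := by
    have h1 := natDegree_derivative_le (ℓ i)
    have h2 := R.natDegree_le i
    have h3 := R.natDegree_le j
    have h4 := natDegree_mul_le (p := derivative (ℓ i)) (q := ℓ j)
    omega
  have h := R.exact _ hd
  simp only [eval_mul, R.eval_node] at h
  have h1 : (ℓ i).eval 1 = if i = Fin.last p then 1 else 0 := by
    have := R.eval_node i (Fin.last p)
    rwa [R.last] at this
  rw [R.matrix_apply, ← h, h1]
  simp

theorem eq_sum (R : SDGRule p s ω ℓ L) {q : ℝ[X]} (hq : q.natDegree ≤ p) :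
    q = ∑ i, C (q.eval (s i)) * ℓ i := by
  have hdeg : ∀ r : ℝ[X], r.natDegree ≤ p →
      r.degree < (Finset.univ : Finset (Fin (p + 1))).card := by
    intro r hr
    rw [Finset.card_univ, Fintype.card_fin]
    exact (natDegree_le_iff_degree_le.1 hr).trans_lt (by exact_mod_cast Nat.lt_succ_self p)
  refine Polynomial.eq_of_degrees_lt_of_eval_index_eq (v := s) Finset.univ
    R.strictMono.injective.injOn (hdeg _ hq) (hdeg _ ?_) fun j _ => ?_
  · exact natDegree_sum_le_of_forall_le _ _ fun i _ => (natDegree_C_mul_le _ _).trans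
      (R.natDegree_le i)
  · simp [eval_finsetSum, R.eval_node]

theorem sum_eval_mul_matrix (R : SDGRule p s ω ℓ L) {q : ℝ[X]} (hq : q.natDegree ≤ p)
    (j : Fin (p + 1)) :
    ∑ i, q.eval (s i) * L i j = ω j * (derivative q).eval (s j)
      - q.eval 1 * (if j = Fin.last p then (1 : ℝ) else 0) := by
  simp only [R.matrix_eq]
  conv_rhs => rw [R.eq_sum hq]
  simp only [eval_finsetSum, derivative_sum, derivative_C_mul, eval_mul, eval_C, Finset.mul_sum,
    Finset.sum_mul, ← Finset.sum_sub_distrib]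
  exact Finset.sum_congr rfl fun i _ => by ring

theorem sum_eval_mul_mulVec (R : SDGRule p s ω ℓ L) {q : ℝ[X]} (hq : q.natDegree ≤ p)
    (y : Fin (p + 1) → ℝ) :
    ∑ i, q.eval (s i) * (L.mulVec y) i
      = ∑ j, ω j * ((derivative q).eval (s j) * y j) - q.eval 1 * y (Fin.last p) := by
  simp only [Matrix.mulVec, dotProduct, Finset.mul_sum]
  rw [Finset.sum_comm]
  simp only [← mul_assoc, ← Finset.sum_mul, R.sum_eval_mul_matrix hq, sub_mul,
    Finset.sum_sub_distrib]
  simp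

theorem mulVec_apply (R : SDGRule p s ω ℓ L) (y : Fin (p + 1) → ℝ) (i : Fin (p + 1)) :
    (L.mulVec y) i
      = ∑ j, ω j * ((derivative (ℓ i)).eval (s j) * y j) - (ℓ i).eval 1 * y (Fin.last p) := by
  rw [← R.sum_eval_mul_mulVec (R.natDegree_le i) y]
  simp [R.eval_node]

theorem sum_weight_mul_eval (R : SDGRule p s ω ℓ L) (i : Fin (p + 1)) :
    (L.mulVec fun j => s j + 1) i = -ω i := by
  have hd : (ℓ i * (X + 1)).natDegree ≤ 2 * p + 1 := by
    have h1 := natDegree_mul_le (p := ℓ i) (q := X + 1)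
    have h2 : (X + 1 : ℝ[X]).natDegree ≤ 1 := by compute_degree
    have h3 := R.natDegree_le i
    omega
  have h := R.sum_eval_derivative hd
  rw [R.mulVec_apply, R.last]
  simp only [derivative_mul, derivative_add, derivative_X, mul_one, eval_add,
    eval_mul, eval_X, R.eval_node, mul_add, mul_ite, mul_zero,
    Finset.sum_add_distrib] at h ⊢
  simp only [Finset.sum_ite_eq, Finset.mem_univ, if_true] at h
  linarith

/-- The coefficient matrix of the implicit Runge-Kutta method the iteration approximates, relative
to the reference interval `[-1, 1]`. -/
noncomputable def _root_.sdgMatrix (ω : Fin (p + 1) → ℝ)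
    (L : Matrix (Fin (p + 1)) (Fin (p + 1)) ℝ) :
    Matrix (Fin (p + 1)) (Fin (p + 1)) ℝ :=
  Matrix.of fun i j => -(L⁻¹ i j * ω j)

theorem mulVec_sdgMatrix (R : SDGRule p s ω ℓ L) (x : Fin (p + 1) → ℝ) :
    L.mulVec ((sdgMatrix ω L).mulVec x) = fun i => -(ω i * x i) := by
  have h : (sdgMatrix ω L).mulVec x = L⁻¹.mulVec fun i => -(ω i * x i) := by
    ext i
    simp only [sdgMatrix, Matrix.mulVec, dotProduct, Matrix.of_apply]
    exact Finset.sum_congr rfl fun j _ => by ring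
  rw [h, Matrix.mulVec_mulVec, Matrix.mul_nonsing_inv _ R.isUnit_det, Matrix.one_mulVec]

theorem sdgMatrix_mulVec_one (R : SDGRule p s ω ℓ L) (i : Fin (p + 1)) :
    ∑ j, sdgMatrix ω L i j = s i + 1 := by
  have h1 : (fun j => s j + 1) = L⁻¹.mulVec fun j => -ω j := by
    have : L.mulVec (fun j => s j + 1) = fun j => -ω j := funext R.sum_weight_mul_eval
    rw [← this, Matrix.mulVec_mulVec, Matrix.nonsing_inv_mul _ R.isUnit_det, Matrix.one_mulVec]
  rw [congrFun h1 i]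
  simp [sdgMatrix, Matrix.mulVec, dotProduct]

/-- Testing the stage equations of the implicit method with a polynomial. -/
theorem sum_test_stage (R : SDGRule p s ω ℓ L) {q : ℝ[X]} (hq : q.natDegree ≤ p) {h : ℝ}
    {x y : Fin (p + 1) → ℝ} (hxy : ∀ i, y i = h / 2 * ∑ j, sdgMatrix ω L i j * x j) :
    ∑ k, ω k * ((derivative q).eval (s k) * y k + h / 2 * (q.eval (s k) * x k))
      = q.eval 1 * y (Fin.last p) := by
  have hy : y = (h / 2) • (sdgMatrix ω L).mulVec x := funext hxy
  have h1 := R.sum_eval_mul_mulVec hq y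
  have h2 : L.mulVec y = (h / 2) • fun i => -(ω i * x i) := by
    rw [hy, Matrix.mulVec_smul, R.mulVec_sdgMatrix]
  rw [h2] at h1
  simp only [mul_add, Finset.sum_add_distrib]
  have h3 : ∑ k, ω k * (h / 2 * (eval (s k) q * x k))
      = -∑ i, eval (s i) q * ((h / 2) • fun i => -(ω i * x i)) i := by
    rw [← Finset.sum_neg_distrib]
    exact Finset.sum_congr rfl fun i _ => by simp only [Pi.smul_apply, smul_eq_mul]; ring
  rw [h3, h1]
  ring

theorem node_mem (R : SDGRule p s ω ℓ L) (i : Fin (p + 1)) : 0 ≤ s i + 1 ∧ s i + 1 ≤ 2 := by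
  have h1 := R.strictMono.monotone (Fin.zero_le i)
  have h2 := R.strictMono.monotone (Fin.le_last i)
  have h3 := R.neg_one_lt
  rw [R.last] at h2
  constructor <;> linarith

theorem sum_pow (R : SDGRule p s ω ℓ L) {m : ℕ} (hm : m + 1 ≤ 2 * p + 1) :
    ∑ k, ω k * ((m + 1) * (s k + 1) ^ m) = 2 ^ (m + 1) := by
  have hd : ((X + 1 : ℝ[X]) ^ (m + 1)).natDegree ≤ 2 * p + 1 :=
    (natDegree_pow_le_of_le (m + 1) (show (X + 1 : ℝ[X]).natDegree ≤ 1 by compute_degree)).trans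
      (by omega)
  have h := R.sum_eval_derivative hd
  simp only [derivative_pow, derivative_add, derivative_X, derivative_one, eval_mul, eval_pow,
    eval_add, eval_X, eval_one, Nat.add_sub_cancel, add_zero, mul_one] at h
  norm_num at h ⊢
  exact h

theorem exists_residual_bound (R : SDGRule p s ω ℓ L) {T : ℝ} (hT : 0 < T) {u u' : ℝ → ℝ}
    (hu : ∀ t ∈ Icc 0 T, HasDerivWithinAt u (u' t) (Icc 0 T) t)
    (hu' : ContDiffOn ℝ (2 * p + 1 : ℕ) u' (Icc 0 T)) {j : ℕ} (hj : j ≤ p) :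
    ∃ C : ℝ, 0 ≤ C ∧ ∀ t h : ℝ, 0 ≤ t → 0 < h → t + h ≤ T →
      |∑ k, ω k * (j * (s k + 1) ^ (j - 1) * (u (t + h / 2 * (s k + 1)) - u t)
          + h / 2 * ((s k + 1) ^ j * u' (t + h / 2 * (s k + 1)))) - 2 ^ j * (u (t + h) - u t)|
        ≤ C * h ^ (2 * p + 2 - j) := by
  obtain ⟨m, hm⟩ : ∃ m, m + j = 2 * p + 1 := ⟨2 * p + 1 - j, by omega⟩
  have hm' : 2 * p + 2 - j = m + 1 := by omega
  obtain ⟨C, hC, H⟩ := exists_taylor_bound_of_deriv hu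
    ((hu'.of_le (by exact_mod_cast (by omega : m ≤ 2 * p + 1))).exists_taylor_bound hT)
  refine ⟨∑ k, |ω k| * (j * 2 ^ (j - 1) * C + 2 ^ j * C) + 2 ^ j * C, by positivity,
    fun t h ht hh hth => ?_⟩
  obtain ⟨c, -, hc0, hcu, hcu'⟩ := H t ⟨ht, by linarith⟩
  have hy : ∀ k, 0 ≤ h / 2 * (s k + 1) ∧ h / 2 * (s k + 1) ≤ h := fun k => by
    have := R.node_mem k
    constructor <;> nlinarith
  set r : ℝ → ℝ := fun y => u (t + y) - ∑ l ∈ Finset.range (m + 1), c l * y ^ l with hr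
  set r' : ℝ → ℝ := fun y => u' (t + y) - ∑ l ∈ Finset.range m, (l + 1) * c (l + 1) * y ^ l with hr'
  have hrb : ∀ y, 0 ≤ y → y ≤ h → |r y| ≤ C * h ^ (m + 1) := fun y h0 h1 => by
    have := hcu (t + y) ⟨by linarith, by linarith⟩
    rw [add_sub_cancel_left, abs_of_nonneg h0] at this
    exact this.trans (by gcongr)
  have hrb' : ∀ y, 0 ≤ y → y ≤ h → |r' y| ≤ C * h ^ m := fun y h0 h1 => by
    have := hcu' (t + y) ⟨by linarith, by linarith⟩
    rw [add_sub_cancel_left, abs_of_nonneg h0] at this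
    exact this.trans (by gcongr)
  have hu1 : ∀ y, u (t + y) - u t = r y + ∑ l ∈ Finset.range m, c (l + 1) * y ^ (l + 1) := by
    intro y
    simp only [hr]
    rw [Finset.sum_range_succ', hc0]
    ring
  have hu2 : ∀ y, u' (t + y) = r' y + ∑ l ∈ Finset.range m, (l + 1) * c (l + 1) * y ^ l := by
    intro y
    simp only [hr']
    ring
  have hpoly : ∑ k, ω k * (j * (s k + 1) ^ (j - 1)
        * (∑ l ∈ Finset.range m, c (l + 1) * (h / 2 * (s k + 1)) ^ (l + 1))
      + h / 2 * ((s k + 1) ^ j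
        * ∑ l ∈ Finset.range m, (l + 1) * c (l + 1) * (h / 2 * (s k + 1)) ^ l))
      = 2 ^ j * ∑ l ∈ Finset.range m, c (l + 1) * h ^ (l + 1) := by
    have h1 : ∀ l ∈ Finset.range m, ∑ k, c (l + 1) * (h / 2) ^ (l + 1) *
        (ω k * (((j + l : ℕ) + 1) * (s k + 1) ^ (j + l)))
        = 2 ^ j * (c (l + 1) * h ^ (l + 1)) := by
      intro l hl
      rw [Finset.mem_range] at hl
      rw [← Finset.mul_sum, R.sum_pow (by omega), add_assoc, pow_add, div_pow]
      field_simp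
      ring
    rw [Finset.mul_sum, ← Finset.sum_congr rfl h1, Finset.sum_comm]
    refine Finset.sum_congr rfl fun k _ => ?_
    simp only [Finset.mul_sum]
    rw [← Finset.sum_add_distrib, Finset.mul_sum]
    refine Finset.sum_congr rfl fun l _ => ?_
    rw [mul_pow, mul_pow]
    rcases j with _ | j
    · simp only [Nat.cast_zero, zero_mul, zero_add, pow_zero]
      ring
    · simp only [Nat.add_sub_cancel]
      push_cast
      ring
  have hsplit : ∑ k, ω k * (j * (s k + 1) ^ (j - 1) * (u (t + h / 2 * (s k + 1)) - u t)
          + h / 2 * ((s k + 1) ^ j * u' (t + h / 2 * (s k + 1)))) - 2 ^ j * (u (t + h) - u t)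
      = ∑ k, ω k * (j * (s k + 1) ^ (j - 1) * r (h / 2 * (s k + 1))
          + h / 2 * ((s k + 1) ^ j * r' (h / 2 * (s k + 1)))) - 2 ^ j * r h := by
    rw [hu1 h, mul_add, ← hpoly, ← sub_sub, sub_right_comm, ← Finset.sum_sub_distrib]
    congr 1
    refine Finset.sum_congr rfl fun k _ => ?_
    rw [hu1, hu2]
    ring
  rw [hsplit, hm', add_mul, Finset.sum_mul]
  refine (abs_sub _ _).trans (add_le_add ((Finset.abs_sum_le_sum_abs _ _).trans
    (Finset.sum_le_sum fun k _ => ?_)) ?_)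
  · rw [abs_mul, mul_assoc |ω k|]
    have hk := R.node_mem k
    have h1 : |(j : ℝ) * (s k + 1) ^ (j - 1) * r (h / 2 * (s k + 1))|
        ≤ j * 2 ^ (j - 1) * (C * h ^ (m + 1)) := by
      rw [abs_mul, abs_of_nonneg (by have := hk.1; positivity)]
      have := hrb _ (hy k).1 (hy k).2
      have := hk.1
      gcongr
      exact hk.2
    have h2 : |h / 2 * ((s k + 1) ^ j * r' (h / 2 * (s k + 1)))|
        ≤ h * (2 ^ j * (C * h ^ m)) := by
      rw [abs_mul, abs_mul, abs_of_pos (by positivity : 0 < h / 2),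
        abs_of_nonneg (pow_nonneg hk.1 _)]
      have := hrb' _ (hy k).1 (hy k).2
      have := hk.1
      gcongr
      · linarith
      · exact hk.2
    gcongr
    calc _ ≤ _ := abs_add_le _ _
      _ ≤ j * 2 ^ (j - 1) * (C * h ^ (m + 1)) + h * (2 ^ j * (C * h ^ m)) := add_le_add h1 h2
      _ = _ := by ring
  · rw [abs_mul, abs_of_pos (by positivity : (0 : ℝ) < 2 ^ j), mul_assoc]
    gcongr
    exact hrb h hh.le le_rfl

/-- The exact solution satisfies the stage equations, tested with powers of `X + 1`, up to the
quadrature error; the bound compares it with any approximate solution of these equations. -/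
theorem exists_error_test_bound (R : SDGRule p s ω ℓ L) {T : ℝ} (hT : 0 < T) {u u' : ℝ → ℝ}
    (hu : ∀ t ∈ Icc 0 T, HasDerivWithinAt u (u' t) (Icc 0 T) t)
    (hu' : ContDiffOn ℝ (2 * p + 1 : ℕ) u' (Icc 0 T)) :
    ∃ C : ℝ, 0 ≤ C ∧ ∀ j ≤ p, ∀ t h ε : ℝ, 0 ≤ t → 0 < h → t + h ≤ T →
      ∀ v x : Fin (p + 1) → ℝ,
      (∀ i, |v i - (u t + h / 2 * ∑ k, sdgMatrix ω L i k * x k)| ≤ ε) →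
      |∑ k, ω k * (j * (s k + 1) ^ (j - 1) * (u (t + h / 2 * (s k + 1)) - v k)
          + h / 2 * ((s k + 1) ^ j * (u' (t + h / 2 * (s k + 1)) - x k)))
          - 2 ^ j * (u (t + h) - v (Fin.last p))|
        ≤ C * (h ^ (2 * p + 2 - j) + ε) := by
  have hex : ∀ j, ∃ C : ℝ, 0 ≤ C ∧ (j ≤ p → ∀ t h : ℝ, 0 ≤ t → 0 < h → t + h ≤ T →
      |∑ k, ω k * (j * (s k + 1) ^ (j - 1) * (u (t + h / 2 * (s k + 1)) - u t)
          + h / 2 * ((s k + 1) ^ j * u' (t + h / 2 * (s k + 1)))) - 2 ^ j * (u (t + h) - u t)|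
        ≤ C * h ^ (2 * p + 2 - j)) := by
    intro j
    by_cases hj : j ≤ p
    · obtain ⟨C, hC, h⟩ := R.exists_residual_bound hT hu hu' hj
      exact ⟨C, hC, fun _ => h⟩
    · exact ⟨0, le_rfl, fun h => absurd h hj⟩
  choose B hB hBr using hex
  refine ⟨∑ j ∈ Finset.range (p + 1), (B j + ∑ k, |ω k| * (j * 2 ^ (j - 1)) + 2 ^ j),
    Finset.sum_nonneg fun j _ => by have := hB j; positivity, fun j hj t h ε ht hh hth v x hv => ?_⟩
  have hε : 0 ≤ ε := (abs_nonneg _).trans (hv 0)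
  have hCj := Finset.single_le_sum
    (f := fun j : ℕ => B j + ∑ k, |ω k| * (j * 2 ^ (j - 1)) + 2 ^ j)
    (fun j _ => by have := hB j; positivity) (Finset.mem_range_succ_iff.2 hj)
  refine le_trans ?_ (mul_le_mul_of_nonneg_right hCj (by positivity))
  set ρ : Fin (p + 1) → ℝ := fun i => v i - (u t + h / 2 * ∑ k, sdgMatrix ω L i k * x k) with hρ
  have hq : ((X + 1 : ℝ[X]) ^ j).natDegree ≤ p :=
    (natDegree_pow_le_of_le j (show (X + 1 : ℝ[X]).natDegree ≤ 1 by compute_degree)).trans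
      (by omega)
  have htest := R.sum_test_stage hq (h := h) (x := x) (y := fun i => v i - u t - ρ i)
    fun i => by simp only [hρ]; ring
  simp only [derivative_pow, derivative_add, derivative_X, derivative_one, eval_mul, eval_pow,
    eval_add, eval_X, eval_one, eval_C, add_zero, mul_one, one_add_one_eq_two] at htest
  have hsplit : ∑ k, ω k * (j * (s k + 1) ^ (j - 1) * (u (t + h / 2 * (s k + 1)) - v k)
          + h / 2 * ((s k + 1) ^ j * (u' (t + h / 2 * (s k + 1)) - x k)))
          - 2 ^ j * (u (t + h) - v (Fin.last p))
      = (∑ k, ω k * (j * (s k + 1) ^ (j - 1) * (u (t + h / 2 * (s k + 1)) - u t)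
          + h / 2 * ((s k + 1) ^ j * u' (t + h / 2 * (s k + 1)))) - 2 ^ j * (u (t + h) - u t))
        - ∑ k, ω k * (j * (s k + 1) ^ (j - 1) * ρ k) + 2 ^ j * ρ (Fin.last p) := by
    have : ∑ k, ω k * (j * (s k + 1) ^ (j - 1) * (u (t + h / 2 * (s k + 1)) - v k)
          + h / 2 * ((s k + 1) ^ j * (u' (t + h / 2 * (s k + 1)) - x k)))
        = ∑ k, ω k * (j * (s k + 1) ^ (j - 1) * (u (t + h / 2 * (s k + 1)) - u t)
          + h / 2 * ((s k + 1) ^ j * u' (t + h / 2 * (s k + 1))))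
        - ∑ k, ω k * (j * (s k + 1) ^ (j - 1) * ρ k)
        - ∑ k, ω k * (j * (s k + 1) ^ (j - 1) * (v k - u t - ρ k)
          + h / 2 * ((s k + 1) ^ j * x k)) := by
      rw [← Finset.sum_sub_distrib, ← Finset.sum_sub_distrib]
      exact Finset.sum_congr rfl fun k _ => by ring
    rw [this, htest]
    ring
  rw [hsplit]
  have h1 := hBr j hj t h ht hh hth
  have h2 : |∑ k, ω k * (j * (s k + 1) ^ (j - 1) * ρ k)|
      ≤ (∑ k, |ω k| * (j * 2 ^ (j - 1))) * ε := by
    rw [Finset.sum_mul]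
    refine (Finset.abs_sum_le_sum_abs _ _).trans (Finset.sum_le_sum fun k _ => ?_)
    have hk := R.node_mem k
    have hk1 := hk.1
    rw [abs_mul, abs_mul, mul_assoc |ω k|, abs_of_nonneg (by positivity :
      0 ≤ (j : ℝ) * (s k + 1) ^ (j - 1))]
    have := hv k
    gcongr
    exact hk.2
  have h3 : |2 ^ j * ρ (Fin.last p)| ≤ 2 ^ j * ε := by
    rw [abs_mul, abs_of_pos (by positivity : (0 : ℝ) < 2 ^ j)]
    have := hv (Fin.last p)
    gcongr
  have hS : 0 ≤ ∑ k, |ω k| * ((j : ℝ) * 2 ^ (j - 1)) := by positivity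
  have hBj := hB j
  have hp : 0 ≤ h ^ (2 * p + 2 - j) := by positivity
  have h2j : (0 : ℝ) < 2 ^ j := by positivity
  refine (abs_add_le _ _).trans ((add_le_add (abs_sub _ _) le_rfl).trans ?_)
  calc _ ≤ B j * h ^ (2 * p + 2 - j) + (∑ k, |ω k| * (j * 2 ^ (j - 1))) * ε + 2 ^ j * ε := by
        linarith
    _ ≤ _ := by nlinarith [mul_nonneg hBj hε, mul_nonneg hS hp, mul_nonneg h2j.le hp]

theorem _root_.Matrix.exists_norm_mulVec_le {n : Type*} [Fintype n] [DecidableEq n]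
    (M : Matrix n n ℝ) : ∃ c : ℝ, 0 ≤ c ∧ ∀ x : n → ℝ, ‖M.mulVec x‖ ≤ c * ‖x‖ :=
  ⟨‖LinearMap.toContinuousLinearMap M.mulVecLin‖, norm_nonneg _,
    fun x => (LinearMap.toContinuousLinearMap M.mulVecLin).le_opNorm x⟩

theorem _root_.Polynomial.exists_eq_sum_X_add_one_pow {q : ℝ[X]} {n : ℕ} (hq : q.natDegree ≤ n) :
    ∃ β : ℕ → ℝ, q = ∑ j ∈ Finset.range (n + 1), C (β j) * (X + 1) ^ j := by
  have hd : (q.comp (X - 1)).natDegree < n + 1 := by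
    have h1 := natDegree_comp_le (p := q) (q := X - 1)
    have h2 : (X - 1 : ℝ[X]).natDegree = 1 := by compute_degree!
    rw [h2, mul_one] at h1
    omega
  refine ⟨(q.comp (X - 1)).coeff, ?_⟩
  have h := congrArg (fun r => r.comp (X + 1)) ((q.comp (X - 1)).as_sum_range_C_mul_X_pow' hd)
  simpa [comp_assoc] using h

theorem sum_mul_test (β : ℕ → ℝ) (n : ℕ) (h : ℝ) (E Δ : Fin (p + 1) → ℝ) :
    ∑ j ∈ Finset.range n, β j * (∑ k, ω k * (j * (s k + 1) ^ (j - 1) * E k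
        + h / 2 * ((s k + 1) ^ j * Δ k)) - 2 ^ j * E (Fin.last p))
      = ∑ k, ω k * ((∑ j ∈ Finset.range n, β j * (j * (s k + 1) ^ (j - 1))) * E k
          + h / 2 * ((∑ j ∈ Finset.range n, β j * (s k + 1) ^ j) * Δ k))
        - (∑ j ∈ Finset.range n, β j * 2 ^ j) * E (Fin.last p) := by
  simp only [mul_sub, Finset.sum_sub_distrib, Finset.mul_sum, Finset.sum_mul]
  congr 1
  · rw [Finset.sum_comm]
    refine Finset.sum_congr rfl fun k _ => ?_
    rw [← Finset.sum_add_distrib, Finset.mul_sum]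
    exact Finset.sum_congr rfl fun j _ => by ring
  · exact Finset.sum_congr rfl fun j _ => by ring

theorem exists_stage_error_bound (R : SDGRule p s ω ℓ L) {T : ℝ} (hT : 0 < T) {u u' : ℝ → ℝ}
    (hu : ∀ t ∈ Icc 0 T, HasDerivWithinAt u (u' t) (Icc 0 T) t)
    (hu' : ContDiffOn ℝ (2 * p + 1 : ℕ) u' (Icc 0 T)) (Λ : NNReal) :
    ∃ C h₀ : ℝ, 0 ≤ C ∧ 0 < h₀ ∧ ∀ t h ε : ℝ, 0 ≤ t → 0 < h → h ≤ h₀ → h ≤ 1 → t + h ≤ T →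
      ∀ v x : Fin (p + 1) → ℝ,
      (∀ i, |v i - (u t + h / 2 * ∑ k, sdgMatrix ω L i k * x k)| ≤ ε) →
      (∀ k, |u' (t + h / 2 * (s k + 1)) - x k| ≤ Λ * |u (t + h / 2 * (s k + 1)) - v k|) →
      ∀ k, |u (t + h / 2 * (s k + 1)) - v k| ≤ C * (h ^ (p + 2) + ε) := by
  obtain ⟨C, hC, H⟩ := R.exists_error_test_bound hT hu hu'
  obtain ⟨c, hc, hcL⟩ := (L⁻¹).exists_norm_mulVec_le
  choose β hβ using fun i => exists_eq_sum_X_add_one_pow (R.natDegree_le i)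
  set D₁ : ℝ := (∑ i, |ω i|) * Λ with hD₁
  set D₂ : ℝ := C * ∑ i, ∑ j ∈ Finset.range (p + 1), |β i j| with hD₂
  have hD₁0 : 0 ≤ D₁ := by positivity
  have hD₂0 : 0 ≤ D₂ := by positivity
  refine ⟨2 * c * D₂, 1 / (2 * (c * D₁ + 1)), by positivity, by positivity,
    fun t h ε ht hh hh₀ hh1 hth v x hv hx k => ?_⟩
  have hε : 0 ≤ ε := (abs_nonneg _).trans (hv 0)
  set E : Fin (p + 1) → ℝ := fun k => u (t + h / 2 * (s k + 1)) - v k with hE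
  set Δ : Fin (p + 1) → ℝ := fun k => u' (t + h / 2 * (s k + 1)) - x k with hΔ
  have hEp : u (t + h) - v (Fin.last p) = E (Fin.last p) := by
    simp only [hE, R.last]
    ring_nf
  have hEk : ∀ k, |E k| ≤ ‖E‖ := fun k => norm_le_pi_norm E k
  have hLE : ∀ i, |(L.mulVec E) i| ≤ D₂ * (h ^ (p + 2) + ε) + D₁ * h * ‖E‖ := by
    intro i
    have h1 := sum_mul_test (s := s) (ω := ω) (β i) (p + 1) h E Δ
    have h2 : ∀ y, (ℓ i).eval y = ∑ j ∈ Finset.range (p + 1), β i j * (y + 1) ^ j := fun y => by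
      conv_lhs => rw [hβ i]
      simp [eval_finsetSum]
    have h3 : ∀ y, (derivative (ℓ i)).eval y
        = ∑ j ∈ Finset.range (p + 1), β i j * (j * (y + 1) ^ (j - 1)) := fun y => by
      conv_lhs => rw [hβ i]
      simp [eval_finsetSum, derivative_pow]
    have h4 := h2 1
    rw [one_add_one_eq_two] at h4
    simp only [← h2, ← h3, ← h4, R.eval_node, mul_add, Finset.sum_add_distrib] at h1
    have h5 := R.mulVec_apply E i
    have h6 : (L.mulVec E) i = ∑ j ∈ Finset.range (p + 1), β i j * (∑ k, ω k *
        (j * (s k + 1) ^ (j - 1) * E k + h / 2 * ((s k + 1) ^ j * Δ k)) - 2 ^ j * E (Fin.last p))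
        - ω i * (h / 2 * Δ i) := by
      simp only [mul_add, Finset.sum_add_distrib]
      rw [h1, h5]
      simp only [ite_mul, one_mul, zero_mul, mul_ite, mul_zero, Finset.sum_ite_eq,
        Finset.mem_univ, if_true]
      ring
    rw [h6]
    refine (abs_sub _ _).trans (add_le_add ?_ ?_)
    · refine (Finset.abs_sum_le_sum_abs _ _).trans ?_
      have h7 : ∑ j ∈ Finset.range (p + 1), |β i j|
          ≤ ∑ i, ∑ j ∈ Finset.range (p + 1), |β i j| :=
        Finset.single_le_sum (f := fun i => ∑ j ∈ Finset.range (p + 1), |β i j|)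
          (fun i _ => by positivity) (Finset.mem_univ i)
      calc _ ≤ ∑ j ∈ Finset.range (p + 1), |β i j| * (C * (h ^ (p + 2) + ε)) := by
            refine Finset.sum_le_sum fun j hj => ?_
            rw [abs_mul]
            have hj' : j ≤ p := Finset.mem_range_succ_iff.1 hj
            have h8 := H j hj' t h ε ht hh hth v x hv
            rw [hEp] at h8
            have h9 : h ^ (2 * p + 2 - j) ≤ h ^ (p + 2) :=
              pow_le_pow_of_le_one hh.le hh1 (by omega)
            refine mul_le_mul_of_nonneg_left (h8.trans ?_) (abs_nonneg _)
            gcongr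
        _ = C * (∑ j ∈ Finset.range (p + 1), |β i j|) * (h ^ (p + 2) + ε) := by
            rw [← Finset.sum_mul]; ring
        _ ≤ _ := by rw [hD₂]; gcongr
    · rw [abs_mul, abs_mul, abs_of_pos (by positivity : 0 < h / 2)]
      have h7 : |ω i| ≤ ∑ i, |ω i| := Finset.single_le_sum (f := fun i => |ω i|)
          (fun i _ => abs_nonneg _) (Finset.mem_univ i)
      have h8 : |Δ i| ≤ Λ * ‖E‖ := (hx i).trans (by have := hEk i; gcongr)
      calc |ω i| * (h / 2 * |Δ i|) ≤ (∑ i, |ω i|) * (h * (Λ * ‖E‖)) := by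
            gcongr
            linarith
        _ = _ := by rw [hD₁]; ring
  have hLE' : ‖L.mulVec E‖ ≤ D₂ * (h ^ (p + 2) + ε) + D₁ * h * ‖E‖ :=
    (pi_norm_le_iff_of_nonneg (by positivity)).2 hLE
  have h1 : ‖E‖ ≤ c * (D₂ * (h ^ (p + 2) + ε) + D₁ * h * ‖E‖) := by
    have := hcL (L.mulVec E)
    rw [Matrix.mulVec_mulVec, Matrix.nonsing_inv_mul _ R.isUnit_det, Matrix.one_mulVec] at this
    exact this.trans (by gcongr)
  have h2 : c * D₁ * h ≤ 1 / 2 := by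
    rw [le_div_iff₀ (by positivity)] at hh₀
    nlinarith
  have h3 : c * D₁ * h * ‖E‖ ≤ 1 / 2 * ‖E‖ := by gcongr
  have h4 := hEk k
  change |E k| ≤ _
  linarith

set_option maxHeartbeats 1000000 in
theorem exists_local_error_bound (R : SDGRule p s ω ℓ L) {T : ℝ} (hT : 0 < T) {u : ℝ → ℝ}
    {f : ℝ → ℝ → ℝ} {Λ : NNReal} (hf : ContDiff ℝ (2 * p + 1 : ℕ) (Function.uncurry f))
    (hLip : ∀ t, LipschitzWith Λ (f t))
    (hu : ∀ t ∈ Icc 0 T, HasDerivWithinAt u (f t (u t)) (Icc 0 T) t) {B : ℝ} (hB : 0 ≤ B) :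
    ∃ C h₀ : ℝ, 0 ≤ C ∧ 0 < h₀ ∧ ∀ t h ε : ℝ, 0 ≤ t → 0 < h → h ≤ h₀ → ε ≤ B → t + h ≤ T →
      ∀ v : Fin (p + 1) → ℝ,
      (∀ i, |v i - (u t + h / 2 * ∑ k, sdgMatrix ω L i k * f (t + h / 2 * (s k + 1)) (v k))| ≤ ε) →
      |u (t + h) - v (Fin.last p)| ≤ C * (h ^ (2 * p + 2) + ε) := by
  have hcomp : ∀ m : ℕ, m ≤ 2 * p + 1 → ContDiffOn ℝ m u (Icc 0 T) →
      ContDiffOn ℝ m (fun t => f t (u t)) (Icc 0 T) := fun m hm h =>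
    (hf.of_le (by exact_mod_cast hm)).comp_contDiffOn (contDiffOn_id.prodMk h)
  have huC := contDiffOn_succ_of_hasDerivWithinAt_bootstrap hT hu hcomp
  have hu' := hcomp _ le_rfl (huC.of_le (by exact_mod_cast Nat.le_succ _))
  obtain ⟨C₂, h₂, hC₂, hh₂, hstage⟩ := R.exists_stage_error_bound hT hu hu' Λ
  have hlip : ∀ t h : ℝ, ∀ v : Fin (p + 1) → ℝ, ∀ k,
      |f (t + h / 2 * (s k + 1)) (u (t + h / 2 * (s k + 1))) - f (t + h / 2 * (s k + 1)) (v k)|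
        ≤ Λ * |u (t + h / 2 * (s k + 1)) - v k| := fun t h v k => (hLip _).dist_le_mul _ _
  have hlast : ∀ t h : ℝ, t + h / 2 * (s (Fin.last p) + 1) = t + h := fun t h => by
    rw [R.last]; ring
  rcases Nat.eq_zero_or_pos p with hp | hp
  · refine ⟨C₂, min h₂ 1, hC₂, by positivity, fun t h ε ht hh hh₀ _ hth v hv => ?_⟩
    have := hstage t h ε ht hh (hh₀.trans (min_le_left _ _)) (hh₀.trans (min_le_right _ _)) hth v _
      hv (hlip t h v) (Fin.last p)
    rw [hlast] at this
    refine this.trans_eq ?_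
    subst hp
    rfl
  obtain ⟨C₁, hC₁, htest⟩ := R.exists_error_test_bound hT hu hu'
  have hf2 : ContDiff ℝ 2 (Function.uncurry f) :=
    hf.of_le (by exact_mod_cast (by omega : 2 ≤ 2 * p + 1))
  obtain ⟨Cq, hCq, hquad⟩ := exists_quadratic_bound hf2 hLip huC.continuousOn
  set a : ℝ → ℝ := fun t => fderiv ℝ (Function.uncurry f) (t, u t) (0, 1) with ha
  have haC : ContDiffOn ℝ p a (Icc 0 T) := by
    have h1 : ContDiff ℝ p (fun z : ℝ × ℝ => fderiv ℝ (Function.uncurry f) z (0, 1)) :=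
      (hf.fderiv_right (m := p) (by exact_mod_cast (by omega : p + 1 ≤ 2 * p + 1))).clm_apply
        contDiff_const
    exact h1.comp_contDiffOn (contDiffOn_id.prodMk
      (huC.of_le (by exact_mod_cast (by omega : p ≤ 2 * p + 1 + 1))))
  obtain ⟨ψ, hψpos, hψC, hψ⟩ := exists_dual_solution hT haC
  have hψ'C : ContDiffOn ℝ p (fun t => -(a t * ψ t)) (Icc 0 T) :=
    (haC.mul (hψC.of_le (by exact_mod_cast Nat.le_succ p))).neg
  obtain ⟨Cψ, hCψ, htaylor⟩ := exists_taylor_bound_of_deriv hψ (hψ'C.exists_taylor_bound hT)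
  obtain ⟨Mψ, hMψ⟩ := isCompact_Icc.exists_bound_of_continuousOn hψC.continuousOn
  obtain ⟨t₁, ht₁, hmin⟩ := isCompact_Icc.exists_isMinOn ⟨0, left_mem_Icc.2 hT.le⟩ hψC.continuousOn
  have hMψ0 : 0 ≤ Mψ := (norm_nonneg _).trans (hMψ 0 (left_mem_Icc.2 hT.le))
  set μ := ψ t₁ with hμdef
  have hμ : 0 < μ := hψpos t₁
  set W : ℝ := ∑ k, |ω k| with hW
  have hW0 : 0 ≤ W := by positivity
  set D : ℝ := (p + 1) * (Cψ * C₁)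
    + W * (Cψ * C₂ + Mψ * Cq * (C₂ ^ 2 * (2 * (1 + B))) + Cψ * Λ * C₂) with hD
  have hD0 : 0 ≤ D := by positivity
  refine ⟨D / (μ / 2), min (min h₂ 1) (μ / (2 * (Cψ + 1))), by positivity, by positivity,
    fun t h ε ht hh hh₀ hεB hth v hv => ?_⟩
  have hε : 0 ≤ ε := (abs_nonneg _).trans (hv 0)
  have hhh₂ : h ≤ h₂ := hh₀.trans ((min_le_left _ _).trans (min_le_left _ _))
  have hh1 : h ≤ 1 := hh₀.trans ((min_le_left _ _).trans (min_le_right _ _))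
  have hhμ : h ≤ μ / (2 * (Cψ + 1)) := hh₀.trans (min_le_right _ _)
  obtain ⟨c, hc, -, hcψ, hcψ'⟩ := htaylor t ⟨ht, by linarith⟩
  have hy : ∀ k, 0 ≤ h / 2 * (s k + 1) ∧ h / 2 * (s k + 1) ≤ h := fun k => by
    have := R.node_mem k
    constructor <;> nlinarith
  set E : Fin (p + 1) → ℝ := fun k => u (t + h / 2 * (s k + 1)) - v k with hE
  set Δ : Fin (p + 1) → ℝ := fun k => f (t + h / 2 * (s k + 1)) (u (t + h / 2 * (s k + 1)))
    - f (t + h / 2 * (s k + 1)) (v k) with hΔ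
  have hEM := hstage t h ε ht hh hhh₂ hh1 hth v _ hv (hlip t h v)
  have hEp : u (t + h) - v (Fin.last p) = E (Fin.last p) := by simp only [hE, hlast]
  set Q : ℝ := h ^ (2 * p + 2) + ε with hQ
  have hQ0 : 0 ≤ Q := by positivity
  set M : ℝ := h ^ (p + 2) + ε with hM
  have hM0 : 0 ≤ M := by positivity
  have hpM : h * h ^ p * M ≤ Q := by
    have h1 : h * h ^ p * h ^ (p + 2) ≤ h ^ (2 * p + 2) := by
      rw [← pow_succ', ← pow_add]
      exact pow_le_pow_of_le_one hh.le hh1 (by omega)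
    have h2 : h * h ^ p * ε ≤ ε := by
      rw [← pow_succ']
      exact mul_le_of_le_one_left hε (pow_le_one₀ hh.le hh1)
    rw [hM, hQ, mul_add]
    linarith
  have hM2 : h * M ^ 2 ≤ 2 * (1 + B) * Q := by
    have h1 : (h ^ (p + 2)) ^ 2 ≤ h ^ (2 * p + 2) := by
      rw [← pow_mul]
      exact pow_le_pow_of_le_one hh.le hh1 (by omega)
    have h2 : ε ^ 2 ≤ B * ε := by nlinarith
    have h3 : h * M ^ 2 ≤ M ^ 2 := mul_le_of_le_one_left (sq_nonneg _) hh1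
    have h4 : 0 ≤ h ^ (2 * p + 2) := by positivity
    rw [hQ]
    nlinarith [sq_nonneg (h ^ (p + 2) - ε), mul_nonneg hB h4]
  have hkey := sum_mul_test (s := s) (ω := ω) (fun j => c j * (h / 2) ^ j) (p + 1) h E Δ
  have hleft : |∑ j ∈ Finset.range (p + 1), c j * (h / 2) ^ j * (∑ k, ω k *
      (j * (s k + 1) ^ (j - 1) * E k + h / 2 * ((s k + 1) ^ j * Δ k)) - 2 ^ j * E (Fin.last p))|
      ≤ (p + 1) * (Cψ * C₁) * Q := by
    refine (Finset.abs_sum_le_sum_abs _ _).trans ?_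
    calc _ ≤ ∑ j ∈ Finset.range (p + 1), Cψ * C₁ * Q := by
          refine Finset.sum_le_sum fun j hj => ?_
          have hj' : j ≤ p := Finset.mem_range_succ_iff.1 hj
          have h1 := htest j hj' t h ε ht hh hth v _ hv
          rw [hEp] at h1
          rw [abs_mul, abs_mul, abs_of_nonneg (by positivity : 0 ≤ (h / 2) ^ j), mul_assoc,
            mul_assoc Cψ]
          refine mul_le_mul (hc j) ?_ (by positivity) hCψ
          refine (mul_le_mul_of_nonneg_left h1 (by positivity)).trans ?_
          have h2 : (h / 2) ^ j ≤ h ^ j := by gcongr; linarith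
          have h3 : h ^ j ≤ 1 := pow_le_one₀ hh.le hh1
          have h4 : h ^ j * h ^ (2 * p + 2 - j) = h ^ (2 * p + 2) := by
            rw [← pow_add]; congr 1; omega
          calc (h / 2) ^ j * (C₁ * (h ^ (2 * p + 2 - j) + ε))
              ≤ h ^ j * (C₁ * (h ^ (2 * p + 2 - j) + ε)) := by gcongr
            _ = C₁ * (h ^ j * h ^ (2 * p + 2 - j) + h ^ j * ε) := by ring
            _ ≤ C₁ * Q := by
              rw [h4, hQ]
              gcongr
              exact mul_le_of_le_one_left hε h3
      _ = _ := by
        rw [Finset.sum_const, Finset.card_range, nsmul_eq_mul]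
        push_cast
        ring
  have hright : |∑ k, ω k * ((∑ j ∈ Finset.range (p + 1), c j * (h / 2) ^ j
        * (j * (s k + 1) ^ (j - 1))) * E k
      + h / 2 * ((∑ j ∈ Finset.range (p + 1), c j * (h / 2) ^ j * (s k + 1) ^ j) * Δ k))|
      ≤ W * (Cψ * C₂ + Mψ * Cq * (C₂ ^ 2 * (2 * (1 + B))) + Cψ * Λ * C₂) * Q := by
    rw [hW, mul_assoc, Finset.sum_mul]
    refine (Finset.abs_sum_le_sum_abs _ _).trans (Finset.sum_le_sum fun k _ => ?_)
    rw [abs_mul]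
    refine mul_le_mul_of_nonneg_left ?_ (abs_nonneg _)
    set y := h / 2 * (s k + 1) with hydef
    have hty : t + y ∈ Icc 0 T := ⟨by linarith [(hy k).1], by linarith [(hy k).2]⟩
    have hs1 : ∑ j ∈ Finset.range (p + 1), c j * (h / 2) ^ j * (s k + 1) ^ j
        = ∑ j ∈ Finset.range (p + 1), c j * y ^ j :=
      Finset.sum_congr rfl fun j _ => by rw [hydef, mul_pow, mul_assoc]
    have hs2 : ∑ j ∈ Finset.range (p + 1), c j * (h / 2) ^ j * (j * (s k + 1) ^ (j - 1))
        = h / 2 * ∑ l ∈ Finset.range p, (l + 1) * c (l + 1) * y ^ l := by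
      rw [Finset.sum_range_succ', Finset.mul_sum]
      simp only [Nat.cast_zero, zero_mul, mul_zero, add_zero, Nat.add_sub_cancel]
      refine Finset.sum_congr rfl fun l _ => ?_
      rw [hydef, mul_pow]
      push_cast
      ring
    have e1 := hcψ (t + y) hty
    have e2 := hcψ' (t + y) hty
    rw [add_sub_cancel_left, abs_of_nonneg (hy k).1] at e1 e2
    set S := ∑ j ∈ Finset.range (p + 1), c j * y ^ j with hS
    set S' := ∑ l ∈ Finset.range p, (l + 1) * c (l + 1) * y ^ l with hS'
    have hE1 : |E k| ≤ C₂ * M := hEM k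
    have hΔ1 : |Δ k| ≤ Λ * (C₂ * M) := (hlip t h v k).trans (by gcongr)
    have hq1 : |Δ k - a (t + y) * E k| ≤ Cq * (C₂ * M) ^ 2 := by
      refine (hquad (t + y) hty (v k)).trans ?_
      rw [← sq_abs]
      gcongr
    have hψb : |ψ (t + y)| ≤ Mψ := hMψ _ hty
    have g1 : |(-(a (t + y) * ψ (t + y)) - S') * E k| ≤ Cψ * h ^ p * (C₂ * M) := by
      rw [abs_mul]
      refine mul_le_mul (e2.trans ?_) hE1 (abs_nonneg _) (by positivity)
      have := (hy k).1
      gcongr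
      exact (hy k).2
    have g2 : |ψ (t + y) * (Δ k - a (t + y) * E k)| ≤ Mψ * (Cq * (C₂ * M) ^ 2) := by
      rw [abs_mul]
      gcongr
    have g3 : |(ψ (t + y) - S) * Δ k| ≤ Cψ * h ^ p * (Λ * (C₂ * M)) := by
      rw [abs_mul]
      refine mul_le_mul (e1.trans ?_) hΔ1 (abs_nonneg _) (by positivity)
      have := (hy k).1
      calc Cψ * y ^ (p + 1) ≤ Cψ * h ^ (p + 1) := by gcongr; exact (hy k).2
        _ ≤ Cψ * h ^ p := by
          gcongr 1
          exact pow_le_pow_of_le_one hh.le hh1 (Nat.le_succ p)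
    have hsplit : h / 2 * S' * E k + h / 2 * (S * Δ k)
        = h / 2 * (ψ (t + y) * (Δ k - a (t + y) * E k)
          - (-(a (t + y) * ψ (t + y)) - S') * E k - (ψ (t + y) - S) * Δ k) := by ring
    rw [hs1, hs2, hsplit, abs_mul, abs_of_pos (by positivity : 0 < h / 2)]
    calc _ ≤ h * (Mψ * (Cq * (C₂ * M) ^ 2) + Cψ * h ^ p * (C₂ * M)
            + Cψ * h ^ p * (Λ * (C₂ * M))) := by
          refine mul_le_mul (by linarith) ?_ (abs_nonneg _) hh.le
          refine (abs_sub _ _).trans (add_le_add ((abs_sub _ _).trans (add_le_add g2 g1)) g3)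
      _ = Cψ * C₂ * (h * h ^ p * M) + Mψ * Cq * (C₂ ^ 2 * (h * M ^ 2))
            + Cψ * Λ * C₂ * (h * h ^ p * M) := by ring
      _ ≤ Cψ * C₂ * Q + Mψ * Cq * (C₂ ^ 2 * (2 * (1 + B) * Q)) + Cψ * Λ * C₂ * Q := by gcongr
      _ = _ := by ring
  have hq1 : μ / 2 ≤ ∑ j ∈ Finset.range (p + 1), c j * (h / 2) ^ j * 2 ^ j := by
    have h1 : ∑ j ∈ Finset.range (p + 1), c j * (h / 2) ^ j * 2 ^ j
        = ∑ j ∈ Finset.range (p + 1), c j * h ^ j :=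
      Finset.sum_congr rfl fun j _ => by rw [mul_assoc, ← mul_pow]; ring_nf
    have hth' : t + h ∈ Icc 0 T := ⟨by linarith, hth⟩
    have h2 := hcψ (t + h) hth'
    rw [add_sub_cancel_left, abs_of_pos hh] at h2
    have h3 : μ ≤ ψ (t + h) := hmin hth'
    have h4 : h ^ (p + 1) ≤ h := pow_le_of_le_one hh.le hh1 (by omega)
    have h5 : Cψ * h ^ (p + 1) ≤ μ / 2 := by
      rw [le_div_iff₀ (by positivity)] at hhμ
      nlinarith
    rw [h1]
    linarith [(abs_le.1 h2).2]
  rw [hEp, div_mul_eq_mul_div, le_div_iff₀ (by positivity)]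
  calc |E (Fin.last p)| * (μ / 2)
      ≤ |E (Fin.last p)| * |∑ j ∈ Finset.range (p + 1), c j * (h / 2) ^ j * 2 ^ j| := by
        gcongr
        exact hq1.trans (le_abs_self _)
    _ = |(∑ j ∈ Finset.range (p + 1), c j * (h / 2) ^ j * 2 ^ j) * E (Fin.last p)| := by
        rw [abs_mul, mul_comm]
    _ ≤ _ := by
        rw [← sub_sub_cancel (∑ k, ω k * ((∑ j ∈ Finset.range (p + 1), c j * (h / 2) ^ j
            * (j * (s k + 1) ^ (j - 1))) * E k
          + h / 2 * ((∑ j ∈ Finset.range (p + 1), c j * (h / 2) ^ j * (s k + 1) ^ j) * Δ k)))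
          ((∑ j ∈ Finset.range (p + 1), c j * (h / 2) ^ j * 2 ^ j) * E (Fin.last p)), ← hkey]
        refine (abs_sub _ _).trans ((add_le_add hright hleft).trans_eq ?_)
        rw [hD]
        ring

end SDGRule

/-- `V k` are the iterates of the explicit SDG scheme on `[t, t + h]` with inflow `w`. -/
structure IsSDGIteration {p : ℕ} (s ω : Fin (p + 1) → ℝ)
    (Ltil : Matrix (Fin (p + 1)) (Fin (p + 1)) ℝ) (f : ℝ → ℝ → ℝ) (h t w : ℝ)
    (V : ℕ → Fin (p + 1) → ℝ) : Prop where
  initial : ∀ m, V 0 m = w + (h / 2 * (s m + 1)) * f t w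
  succ_zero : ∀ k, V (k + 1) 0
    = w + h / 2 * ∑ j, Ltil 0 j * ω j * f (t + h / 2 * (s j + 1)) (V k j)
  succ_succ : ∀ k (m : Fin p), V (k + 1) m.succ = V (k + 1) m.castSucc
    + h / 2 * ω m.castSucc * (f (t + h / 2 * (s m.castSucc + 1)) (V (k + 1) m.castSucc)
      - f (t + h / 2 * (s m.castSucc + 1)) (V k m.castSucc))
    + h / 2 * ∑ j, Ltil m.succ j * ω j * f (t + h / 2 * (s j + 1)) (V k j)

/-- The values of `f` at the stages `v`. -/
noncomputable def stageValues {p : ℕ} (s : Fin (p + 1) → ℝ) (f : ℝ → ℝ → ℝ) (h t : ℝ)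
    (v : Fin (p + 1) → ℝ) : Fin (p + 1) → ℝ :=
  fun j => f (t + h / 2 * (s j + 1)) (v j)

/-- The strictly lower triangular matrix of the sweep over the nodes. -/
def sweepMatrix {p : ℕ} (ω : Fin (p + 1) → ℝ) : Matrix (Fin (p + 1)) (Fin (p + 1)) ℝ :=
  Matrix.of fun m j => if j < m then ω j else 0

namespace IsSDGIteration

variable {p : ℕ} {s ω : Fin (p + 1) → ℝ} {L Ltil : Matrix (Fin (p + 1)) (Fin (p + 1)) ℝ}
  {f : ℝ → ℝ → ℝ}

theorem exists_iteration (s ω : Fin (p + 1) → ℝ) (Ltil : Matrix (Fin (p + 1)) (Fin (p + 1)) ℝ)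
    (f : ℝ → ℝ → ℝ) (h t w : ℝ) : ∃ V, IsSDGIteration s ω Ltil f h t w V := by
  let next : (Fin (p + 1) → ℝ) → Fin (p + 1) → ℝ := fun v m =>
    Fin.induction (motive := fun _ => ℝ)
      (w + h / 2 * ∑ j, Ltil 0 j * ω j * f (t + h / 2 * (s j + 1)) (v j))
      (fun m x => x + h / 2 * ω m.castSucc * (f (t + h / 2 * (s m.castSucc + 1)) x
          - f (t + h / 2 * (s m.castSucc + 1)) (v m.castSucc))
        + h / 2 * ∑ j, Ltil m.succ j * ω j * f (t + h / 2 * (s j + 1)) (v j)) m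
  exact ⟨fun k => Nat.rec (fun m => w + (h / 2 * (s m + 1)) * f t w) (fun _ v => next v) k,
    fun _ => rfl, fun _ => rfl, fun _ _ => rfl⟩

theorem succ_eq {h t w : ℝ} {V : ℕ → Fin (p + 1) → ℝ} (hV : IsSDGIteration s ω Ltil f h t w V)
    (hLtil0 : ∀ j, Ltil 0 j = -(L⁻¹ 0 j))
    (hLtilS : ∀ (m : Fin p) (j : Fin (p + 1)), Ltil m.succ j = L⁻¹ m.castSucc j - L⁻¹ m.succ j)
    (k : ℕ) :
    V (k + 1) = (fun _ => w) + (h / 2) • ((sdgMatrix ω L).mulVec (stageValues s f h t (V k))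
      + (sweepMatrix ω).mulVec (stageValues s f h t (V (k + 1)) - stageValues s f h t (V k))) := by
  funext m
  simp only [Pi.add_apply, Pi.smul_apply, smul_eq_mul, Matrix.mulVec, dotProduct]
  induction m using Fin.induction with
  | zero =>
    rw [hV.succ_zero]
    simp [sdgMatrix, sweepMatrix, stageValues, hLtil0]
  | succ m ih =>
    have h1 : ∑ j, sweepMatrix ω m.succ j
          * (stageValues s f h t (V (k + 1)) - stageValues s f h t (V k)) j
        = ∑ j, sweepMatrix ω m.castSucc j
          * (stageValues s f h t (V (k + 1)) - stageValues s f h t (V k)) j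
        + ω m.castSucc
          * (stageValues s f h t (V (k + 1)) - stageValues s f h t (V k)) m.castSucc := by
      rw [← sub_eq_iff_eq_add', ← Finset.sum_sub_distrib,
        Finset.sum_eq_single_of_mem m.castSucc (Finset.mem_univ _)]
      · simp [sweepMatrix]
      · intro j _ hj
        have : (j < m.succ) = (j < m.castSucc) := by
          rw [Fin.lt_def, Fin.lt_def, eq_iff_iff]
          have : (j : ℕ) ≠ m := fun h => hj (Fin.ext h)
          simp only [Fin.val_succ, Fin.val_castSucc]
          omega
        simp [sweepMatrix, this]
    have h2 : ∑ j, sdgMatrix ω L m.succ j * stageValues s f h t (V k) j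
        = ∑ j, sdgMatrix ω L m.castSucc j * stageValues s f h t (V k) j
        + ∑ j, Ltil m.succ j * ω j * f (t + h / 2 * (s j + 1)) (V k j) := by
      rw [← Finset.sum_add_distrib]
      refine Finset.sum_congr rfl fun j _ => ?_
      simp only [sdgMatrix, Matrix.of_apply, stageValues, hLtilS]
      ring
    rw [hV.succ_succ, h1, h2]
    simp only [Pi.sub_apply, stageValues] at ih ⊢
    linear_combination ih

theorem norm_stageValues_sub_le {Λ : NNReal} (hLip : ∀ t, LipschitzWith Λ (f t)) (h t : ℝ)
    (v v' : Fin (p + 1) → ℝ) :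
    ‖stageValues s f h t v - stageValues s f h t v'‖ ≤ Λ * ‖v - v'‖ := by
  refine (pi_norm_le_iff_of_nonneg (by positivity)).2 fun j => ?_
  refine ((hLip _).dist_le_mul _ _).trans ?_
  have : dist (v j) (v' j) ≤ ‖v - v'‖ := norm_le_pi_norm (v - v') j
  gcongr

theorem norm_residual_le {h t w : ℝ} {V : ℕ → Fin (p + 1) → ℝ} {Λ : NNReal} {c : ℝ}
    (hV : IsSDGIteration s ω Ltil f h t w V)
    (hLtil0 : ∀ j, Ltil 0 j = -(L⁻¹ 0 j))
    (hLtilS : ∀ (m : Fin p) (j : Fin (p + 1)), Ltil m.succ j = L⁻¹ m.castSucc j - L⁻¹ m.succ j)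
    (hLip : ∀ t, LipschitzWith Λ (f t)) (hh : 0 < h) (hc : 0 ≤ c)
    (hA : ∀ x, ‖(sdgMatrix ω L).mulVec x‖ ≤ c * ‖x‖)
    (hS : ∀ x, ‖(sweepMatrix ω).mulVec x‖ ≤ c * ‖x‖)
    (hhc : h * (c * Λ) ≤ 1) (k : ℕ) :
    ‖V k - ((fun _ => w) + (h / 2) • (sdgMatrix ω L).mulVec (stageValues s f h t (V k)))‖
      ≤ (h * (2 * c * Λ)) ^ k
        * ‖V 0
          - ((fun _ => w) + (h / 2) • (sdgMatrix ω L).mulVec (stageValues s f h t (V 0)))‖ := by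
  induction k with
  | zero => simp
  | succ k ih =>
    set ρ := V k - ((fun _ => w) + (h / 2) • (sdgMatrix ω L).mulVec (stageValues s f h t (V k)))
      with hρ
    have hstep := hV.succ_eq hLtil0 hLtilS k
    set Δ := stageValues s f h t (V (k + 1)) - stageValues s f h t (V k) with hΔ
    have hΔn : ‖Δ‖ ≤ Λ * ‖V (k + 1) - V k‖ := norm_stageValues_sub_le hLip _ _ _ _
    have h1 : V (k + 1) - V k = (h / 2) • (sweepMatrix ω).mulVec Δ - ρ := by
      rw [hρ, hstep, smul_add]
      abel
    have hSn : ‖(h / 2) • (sweepMatrix ω).mulVec Δ‖ ≤ h / 2 * (c * (Λ * ‖V (k + 1) - V k‖)) := by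
      rw [norm_smul, Real.norm_of_nonneg (by positivity)]
      gcongr
      exact (hS _).trans (by gcongr)
    have hAn : ‖(h / 2) • (sdgMatrix ω L).mulVec Δ‖ ≤ h / 2 * (c * (Λ * ‖V (k + 1) - V k‖)) := by
      rw [norm_smul, Real.norm_of_nonneg (by positivity)]
      gcongr
      exact (hA _).trans (by gcongr)
    have h2 : ‖V (k + 1) - V k‖ ≤ 2 * ‖ρ‖ := by
      have h3 : ‖V (k + 1) - V k‖ ≤ ‖(h / 2) • (sweepMatrix ω).mulVec Δ‖ + ‖ρ‖ :=
        h1 ▸ norm_sub_le _ _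
      nlinarith [norm_nonneg (V (k + 1) - V k)]
    have h4 : V (k + 1) - ((fun _ => w)
        + (h / 2) • (sdgMatrix ω L).mulVec (stageValues s f h t (V (k + 1))))
        = (h / 2) • (sweepMatrix ω).mulVec Δ - (h / 2) • (sdgMatrix ω L).mulVec Δ := by
      have h5 : stageValues s f h t (V (k + 1)) = stageValues s f h t (V k) + Δ := by
        rw [hΔ]; abel
      nth_rewrite 1 [hstep]
      rw [h5, Matrix.mulVec_add, smul_add, smul_add]
      abel
    rw [h4]
    calc _ ≤ _ := norm_sub_le _ _
      _ ≤ h * (c * Λ) * ‖V (k + 1) - V k‖ := by linarith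
      _ ≤ h * (c * Λ) * (2 * ‖ρ‖) := by gcongr
      _ = h * (2 * c * Λ) * ‖ρ‖ := by ring
      _ ≤ h * (2 * c * Λ) * _ := mul_le_mul_of_nonneg_left ih (by positivity)
      _ = _ := by rw [pow_succ']; ring

theorem exists_stability_bound {Λ : NNReal} {c : ℝ}
    (hLtil0 : ∀ j, Ltil 0 j = -(L⁻¹ 0 j))
    (hLtilS : ∀ (m : Fin p) (j : Fin (p + 1)), Ltil m.succ j = L⁻¹ m.castSucc j - L⁻¹ m.succ j)
    (hLip : ∀ t, LipschitzWith Λ (f t)) (hc : 0 ≤ c) (hs : ∀ i, 0 ≤ s i + 1 ∧ s i + 1 ≤ 2)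
    (hA : ∀ x, ‖(sdgMatrix ω L).mulVec x‖ ≤ c * ‖x‖)
    (hS : ∀ x, ‖(sweepMatrix ω).mulVec x‖ ≤ c * ‖x‖)
    (k : ℕ) :
    ∃ G : ℝ, 0 ≤ G ∧ ∀ h t w w' : ℝ, ∀ V V' : ℕ → Fin (p + 1) → ℝ, 0 < h → h ≤ 1 →
      h * (c * Λ) ≤ 1 → IsSDGIteration s ω Ltil f h t w V → IsSDGIteration s ω Ltil f h t w' V' →
      ‖V k - V' k‖ ≤ (1 + G * h) * |w - w'| := by
  induction k with
  | zero =>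
    refine ⟨Λ, Λ.coe_nonneg, fun h t w w' V V' hh hh1 _ hV hV' => ?_⟩
    refine (pi_norm_le_iff_of_nonneg (by positivity)).2 fun m => ?_
    have h1 : |f t w - f t w'| ≤ Λ * |w - w'| := (hLip t).dist_le_mul w w'
    have hm := hs m
    rw [Pi.sub_apply, hV.initial, hV'.initial, Real.norm_eq_abs]
    have hy0 : 0 ≤ h / 2 * (s m + 1) := mul_nonneg (by positivity) hm.1
    have hy1 : h / 2 * (s m + 1) ≤ h := by nlinarith
    calc |w + h / 2 * (s m + 1) * f t w - (w' + h / 2 * (s m + 1) * f t w')|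
        = |(w - w') + h / 2 * (s m + 1) * (f t w - f t w')| := by congr 1; ring
      _ ≤ |w - w'| + h / 2 * (s m + 1) * |f t w - f t w'| := by
        refine (abs_add_le _ _).trans_eq ?_
        rw [abs_mul, abs_of_nonneg hy0]
      _ ≤ |w - w'| + h * (Λ * |w - w'|) := by gcongr
      _ = _ := by ring
  | succ k ih =>
    obtain ⟨G, hG, H⟩ := ih
    have hcΛ : 0 ≤ c * Λ := by positivity
    refine ⟨c * Λ * (2 + 2 * (c * Λ) * (1 + G) + 2 * (1 + G)), by positivity,
      fun h t w w' V V' hh hh1 hhc hV hV' => ?_⟩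
    have hk := H h t w w' V V' hh hh1 hhc hV hV'
    set x := ‖V k - V' k‖ with hx
    set y := ‖V (k + 1) - V' (k + 1)‖ with hy
    set e := |w - w'| with he
    have he0 : 0 ≤ e := abs_nonneg _
    have hx0 : 0 ≤ x := norm_nonneg _
    have hy0 : 0 ≤ y := norm_nonneg _
    have hx1 : x ≤ (1 + G) * e := hk.trans (by gcongr; nlinarith)
    have hdiff : V (k + 1) - V' (k + 1) = (fun _ => w - w') + (h / 2) •
        ((sdgMatrix ω L).mulVec (stageValues s f h t (V k) - stageValues s f h t (V' k))
        + (sweepMatrix ω).mulVec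
          ((stageValues s f h t (V (k + 1)) - stageValues s f h t (V' (k + 1)))
          - (stageValues s f h t (V k) - stageValues s f h t (V' k)))) := by
      ext i
      have a1 := congrFun (hV.succ_eq hLtil0 hLtilS k) i
      have a2 := congrFun (hV'.succ_eq hLtil0 hLtilS k) i
      simp only [Matrix.mulVec_sub, Pi.sub_apply, Pi.add_apply, Pi.smul_apply, smul_eq_mul]
        at a1 a2 ⊢
      linear_combination a1 - a2
    have h1 : ‖(fun _ : Fin (p + 1) => w - w')‖ ≤ e := pi_norm_const_le (w - w')
    have hFx := norm_stageValues_sub_le (s := s) hLip h t (V k) (V' k)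
    have hFy := norm_stageValues_sub_le (s := s) hLip h t (V (k + 1)) (V' (k + 1))
    rw [← hx] at hFx
    rw [← hy] at hFy
    have h2 : y ≤ e + h / 2 * (c * (Λ * x) + c * (Λ * y + Λ * x)) := by
      refine ((congrArg norm hdiff).trans_le (norm_add_le _ _)).trans (add_le_add h1 ?_)
      rw [norm_smul, Real.norm_of_nonneg (by positivity)]
      refine mul_le_mul_of_nonneg_left ((norm_add_le _ _).trans (add_le_add ?_ ?_)) (by positivity)
      · exact (hA _).trans (by gcongr)
      · refine (hS _).trans ?_
        gcongr
        exact (norm_sub_le _ _).trans (add_le_add hFy hFx)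
    have h3 : y ≤ 2 * e + 2 * (c * Λ) * x := by
      have : h * (c * Λ) * y ≤ 1 * y := by gcongr
      have : h * ((c * Λ) * x) ≤ 1 * ((c * Λ) * x) := by gcongr
      nlinarith
    have h4 : y ≤ 2 * e + 2 * (c * Λ) * ((1 + G) * e) := h3.trans (by gcongr)
    calc y ≤ e + h / 2 * (c * (Λ * x) + c * (Λ * y + Λ * x)) := h2
      _ = e + h * (c * Λ) * (1 / 2 * y + x) := by ring
      _ ≤ e + h * (c * Λ) * ((2 * e + 2 * (c * Λ) * ((1 + G) * e)) + 2 * ((1 + G) * e)) := by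
        gcongr
        · linarith
        · linarith
      _ = _ := by ring

end IsSDGIteration

open Set in
theorem ContDiffOn.exists_abs_sub_le {T : ℝ} (hT : 0 < T) {g : ℝ → ℝ}
    (hg : ContDiffOn ℝ (1 : ℕ) g (Icc 0 T)) :
    ∃ C : ℝ, 0 ≤ C ∧ ∀ t₀ ∈ Icc 0 T, ∀ t ∈ Icc 0 T, |g t - g t₀| ≤ C * |t - t₀| := by
  obtain ⟨C, hC, H⟩ := hg.exists_taylor_bound hT
  refine ⟨C, hC, fun t₀ ht₀ t ht => ?_⟩
  obtain ⟨c, -, hc⟩ := H t₀ ht₀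
  have h0 := hc t₀ ht₀
  have h1 := hc t ht
  simp only [Finset.range_one, Finset.sum_singleton, pow_zero, mul_one, pow_one, sub_self, abs_zero,
    mul_zero] at h0 h1
  rwa [sub_eq_zero.1 (abs_nonpos_iff.1 h0)]

theorem le_of_affine_recurrence {e : ℕ → ℝ} {h G D : ℝ} (hh : 0 ≤ h) (hG : 0 ≤ G) (hD : 0 ≤ D)
    (h0 : e 0 ≤ 0) {N : ℕ} (hstep : ∀ n < N, e (n + 1) ≤ D + (1 + G * h) * e n) :
    ∀ n ≤ N, e n ≤ n * D * Real.exp (G * (n * h)) := by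
  intro n
  induction n with
  | zero => intro _; simpa using h0
  | succ n ih =>
    intro hn
    have h1 : 1 + G * h ≤ Real.exp (G * h) := by
      rw [add_comm]; exact Real.add_one_le_exp _
    have h2 : 1 ≤ Real.exp (G * ((n + 1 : ℕ) * h)) := Real.one_le_exp (by positivity)
    have h3 : Real.exp (G * ((n + 1 : ℕ) * h))
        = Real.exp (G * h) * Real.exp (G * (n * h)) := by
      rw [← Real.exp_add]; push_cast; ring_nf
    calc e (n + 1) ≤ D + (1 + G * h) * e n := hstep n hn
      _ ≤ D * Real.exp (G * ((n + 1 : ℕ) * h))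
          + Real.exp (G * h) * (n * D * Real.exp (G * (n * h))) := by
        refine add_le_add (le_mul_of_one_le_right hD h2) ?_
        exact (mul_le_mul_of_nonneg_left (ih (by omega)) (by positivity)).trans
          (mul_le_mul_of_nonneg_right h1 (by positivity))
      _ = _ := by rw [h3]; push_cast; ring

namespace IsSDGIteration

open Polynomial Set

variable {p : ℕ} {s ω : Fin (p + 1) → ℝ} {ℓ : Fin (p + 1) → ℝ[X]}
  {L Ltil : Matrix (Fin (p + 1)) (Fin (p + 1)) ℝ} {f : ℝ → ℝ → ℝ} {Λ : NNReal} {u : ℝ → ℝ} {T : ℝ}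

theorem exists_initial_residual_bound (R : SDGRule p s ω ℓ L) (hT : 0 < T)
    (hf : ContDiff ℝ (1 : ℕ) (Function.uncurry f)) (hLip : ∀ t, LipschitzWith Λ (f t))
    (hu : ∀ t ∈ Icc 0 T, HasDerivWithinAt u (f t (u t)) (Icc 0 T) t) :
    ∃ C : ℝ, 0 ≤ C ∧ ∀ t h : ℝ, ∀ V : ℕ → Fin (p + 1) → ℝ, 0 ≤ t → 0 < h → t + h ≤ T →
      IsSDGIteration s ω Ltil f h t (u t) V →
      ‖V 0 - ((fun _ => u t) + (h / 2) • (sdgMatrix ω L).mulVec (stageValues s f h t (V 0)))‖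
        ≤ C * h ^ 2 := by
  have hcomp : ∀ m : ℕ, m ≤ 1 → ContDiffOn ℝ m u (Icc 0 T) →
      ContDiffOn ℝ m (fun t => f t (u t)) (Icc 0 T) := fun m hm h =>
    (hf.of_le (by exact_mod_cast hm)).comp_contDiffOn (contDiffOn_id.prodMk h)
  have huC := (contDiffOn_succ_of_hasDerivWithinAt_bootstrap hT hu hcomp).of_le
    (m := (1 : ℕ)) (by exact_mod_cast Nat.le_succ _)
  have hu' := hcomp 1 le_rfl huC
  obtain ⟨C₁, hC₁, H₁⟩ := huC.exists_abs_sub_le hT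
  obtain ⟨C₂, hC₂, H₂⟩ := hu'.exists_abs_sub_le hT
  obtain ⟨M, hM⟩ := isCompact_Icc.exists_bound_of_continuousOn hu'.continuousOn
  have hM0 : 0 ≤ M := (norm_nonneg _).trans (hM 0 ⟨le_rfl, hT.le⟩)
  obtain ⟨c, hc, hA⟩ := (sdgMatrix ω L).exists_norm_mulVec_le
  refine ⟨c * (C₂ + Λ * (C₁ + M)), by positivity, fun t h V ht hh hth hV => ?_⟩
  set δ : Fin (p + 1) → ℝ := (fun _ => f t (u t)) - stageValues s f h t (V 0) with hδ
  have hres : V 0 - ((fun _ => u t)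
      + (h / 2) • (sdgMatrix ω L).mulVec (stageValues s f h t (V 0)))
      = (h / 2) • (sdgMatrix ω L).mulVec δ := by
    ext i
    have h1 : (sdgMatrix ω L).mulVec (fun _ => f t (u t)) i = (s i + 1) * f t (u t) := by
      rw [← R.sdgMatrix_mulVec_one i, Finset.sum_mul]; rfl
    simp only [hδ, Matrix.mulVec_sub, Pi.sub_apply, Pi.add_apply, Pi.smul_apply, smul_eq_mul, h1,
      hV.initial]
    ring
  have hδn : ‖δ‖ ≤ (C₂ + Λ * (C₁ + M)) * h := by
    refine (pi_norm_le_iff_of_nonneg (by positivity)).2 fun j => ?_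
    have hj := R.node_mem j
    set y := h / 2 * (s j + 1) with hy
    have hy0 : 0 ≤ y := mul_nonneg (by positivity) hj.1
    have hyh : y ≤ h := by nlinarith
    have htI : t ∈ Icc 0 T := ⟨ht, by linarith⟩
    have hyI : t + y ∈ Icc 0 T := ⟨by linarith, by linarith⟩
    have e1 := H₁ _ hyI _ htI
    have e2 := H₂ _ hyI _ htI
    rw [sub_add_cancel_left, abs_neg, abs_of_nonneg hy0] at e1 e2
    have e3 : |u (t + y) - V 0 j| ≤ (C₁ + M) * h := by
      have h3 : u (t + y) - V 0 j = -(u t - u (t + y)) - y * f t (u t) := by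
        rw [hV.initial]; ring
      have h4 : |y * f t (u t)| ≤ h * M := by
        rw [abs_mul, abs_of_nonneg hy0]
        exact mul_le_mul hyh (hM t htI) (abs_nonneg _) hh.le
      rw [h3]
      refine (abs_sub _ _).trans ?_
      rw [abs_neg]
      nlinarith
    have e4 : |f (t + y) (u (t + y)) - f (t + y) (V 0 j)| ≤ Λ * |u (t + y) - V 0 j| :=
      (hLip _).dist_le_mul _ _
    have e5 : δ j = (f t (u t) - f (t + y) (u (t + y)))
        + (f (t + y) (u (t + y)) - f (t + y) (V 0 j)) := by
      simp [hδ, stageValues, hy]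
    rw [e5]
    calc _ ≤ _ := norm_add_le _ _
      _ ≤ C₂ * h + Λ * ((C₁ + M) * h) :=
        add_le_add (e2.trans (by gcongr)) (e4.trans (by gcongr))
      _ = _ := by ring
  rw [hres, norm_smul, Real.norm_of_nonneg (by positivity)]
  calc h / 2 * ‖(sdgMatrix ω L).mulVec δ‖ ≤ h * (c * ((C₂ + Λ * (C₁ + M)) * h)) := by
        gcongr
        · linarith
        · exact (hA δ).trans (by gcongr)
    _ = _ := by ring

/-- The local error of one step of the SDG method, together with its stability. -/
theorem exists_step_bound (R : SDGRule p s ω ℓ L)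
    (hLtil0 : ∀ j, Ltil 0 j = -(L⁻¹ 0 j))
    (hLtilS : ∀ (m : Fin p) (j : Fin (p + 1)), Ltil m.succ j = L⁻¹ m.castSucc j - L⁻¹ m.succ j)
    (hT : 0 < T) (hf : ContDiff ℝ (2 * p + 1 : ℕ) (Function.uncurry f))
    (hLip : ∀ t, LipschitzWith Λ (f t))
    (hu : ∀ t ∈ Icc 0 T, HasDerivWithinAt u (f t (u t)) (Icc 0 T) t) (K : ℕ) :
    ∃ D G h₀ : ℝ, 0 ≤ D ∧ 0 ≤ G ∧ 0 < h₀ ∧ ∀ t h w : ℝ, ∀ V : ℕ → Fin (p + 1) → ℝ,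
      0 ≤ t → 0 < h → h ≤ h₀ → t + h ≤ T → IsSDGIteration s ω Ltil f h t w V →
      |u (t + h) - V K (Fin.last p)|
        ≤ D * h ^ (min (2 * p + 1) (K + 1) + 1) + (1 + G * h) * |u t - w| := by
  obtain ⟨cA, hcA, hA⟩ := (sdgMatrix ω L).exists_norm_mulVec_le
  obtain ⟨cS, hcS, hS⟩ := (sweepMatrix ω).exists_norm_mulVec_le
  set c := max cA cS with hc
  have hc0 : 0 ≤ c := hcA.trans (le_max_left _ _)
  replace hA : ∀ x, ‖(sdgMatrix ω L).mulVec x‖ ≤ c * ‖x‖ := fun x =>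
    (hA x).trans (by gcongr; exact le_max_left _ _)
  replace hS : ∀ x, ‖(sweepMatrix ω).mulVec x‖ ≤ c * ‖x‖ := fun x =>
    (hS x).trans (by gcongr; exact le_max_right _ _)
  obtain ⟨C₀, hC₀, H₀⟩ := exists_initial_residual_bound (Ltil := Ltil) R hT
    (hf.of_le (by exact_mod_cast Nat.le_add_left _ _)) hLip hu
  set CK := (2 * c * Λ) ^ K * C₀ with hCK
  have hCK0 : 0 ≤ CK := by positivity
  obtain ⟨C₁, h₁, hC₁, hh₁, H₁⟩ := R.exists_local_error_bound hT hf hLip hu hCK0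
  obtain ⟨G, hG, HG⟩ := exists_stability_bound hLtil0 hLtilS hLip hc0 R.node_mem hA hS K
  refine ⟨C₁ * (1 + CK), G, min h₁ (min 1 (1 / (c * Λ + 1))), by positivity, hG, by positivity,
    fun t h w V ht hh hhm hth hV => ?_⟩
  have hh1 : h ≤ 1 := hhm.trans ((min_le_right _ _).trans (min_le_left _ _))
  have hhc : h * (c * Λ) ≤ 1 := by
    have := hhm.trans ((min_le_right _ _).trans (min_le_right _ _))
    rw [le_div_iff₀ (by positivity)] at this
    linarith
  obtain ⟨W, hW⟩ := exists_iteration s ω Ltil f h t (u t)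
  have hε : ‖W K - ((fun _ => u t)
      + (h / 2) • (sdgMatrix ω L).mulVec (stageValues s f h t (W K)))‖ ≤ CK * h ^ (K + 2) := by
    refine (hW.norm_residual_le hLtil0 hLtilS hLip hh hc0 hA hS hhc K).trans ?_
    calc _ ≤ (h * (2 * c * Λ)) ^ K * (C₀ * h ^ 2) := by
          gcongr
          exact H₀ t h W ht hh hth hW
      _ = _ := by rw [hCK]; ring
  have hloc := H₁ t h (CK * h ^ (K + 2)) ht hh (hhm.trans (min_le_left _ _))
    (mul_le_of_le_one_right hCK0 (pow_le_one₀ hh.le hh1)) hth (W K)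
    fun i => (norm_le_pi_norm _ i).trans hε
  have hstab : |W K (Fin.last p) - V K (Fin.last p)| ≤ (1 + G * h) * |u t - w| :=
    (norm_le_pi_norm (W K - V K) (Fin.last p)).trans (HG h t (u t) w W V hh hh1 hhc hW hV)
  have hp1 : h ^ (2 * p + 2) ≤ h ^ (min (2 * p + 1) (K + 1) + 1) :=
    pow_le_pow_of_le_one hh.le hh1 (by omega)
  have hp2 : h ^ (K + 2) ≤ h ^ (min (2 * p + 1) (K + 1) + 1) :=
    pow_le_pow_of_le_one hh.le hh1 (by omega)
  calc |u (t + h) - V K (Fin.last p)|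
      ≤ |u (t + h) - W K (Fin.last p)| + |W K (Fin.last p) - V K (Fin.last p)| :=
        abs_sub_le _ _ _
    _ ≤ C₁ * (h ^ (min (2 * p + 1) (K + 1) + 1) + CK * h ^ (min (2 * p + 1) (K + 1) + 1))
        + (1 + G * h) * |u t - w| := by
        refine add_le_add (hloc.trans ?_) hstab
        gcongr
    _ = _ := by ring

end IsSDGIteration

/-- Global error of the explicit SDG method. On a uniform partition of
`[0, T]` with `h = T/N`, `t_n = n h`, the numerical values `u_n^N` produced by the explicit
SDG scheme with `K` iterations per step satisfy
`max_{0 ≤ n ≤ N} |u(t_n) - u_n^N| ≤ C h^{min(2p+1, K+1)}` for all sufficiently large `N`;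
i.e. the explicit SDG method with `K` iterations has order `min(2p+1, K+1)`. -/
theorem sdg_explicit_global_error (p K : ℕ) (s ω : Fin (p + 1) → ℝ)
    (hs : StrictMono s) (hs0 : (-1 : ℝ) < s 0) (hsp : s (Fin.last p) = 1)
    (hω : ∀ i, 0 < ω i)
    (hexact : ∀ q : Polynomial ℝ, q.natDegree ≤ 2 * p →
      ∑ i, ω i * q.eval (s i) = ∫ x in (-1:ℝ)..1, q.eval x)
    (ℓ : Fin (p + 1) → Polynomial ℝ)
    (hdeg : ∀ i, (ℓ i).natDegree ≤ p)
    (hval : ∀ i j, (ℓ i).eval (s j) = if i = j then 1 else 0)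
    (L : Matrix (Fin (p + 1)) (Fin (p + 1)) ℝ)
    (hLdef : ∀ i j, L i j =
      (∫ x in (-1:ℝ)..1, (Polynomial.derivative (ℓ i)).eval x * (ℓ j).eval x)
        - (if i = Fin.last p then (1:ℝ) else 0) * (if j = Fin.last p then (1:ℝ) else 0))
    (hLinv : IsUnit L.det)
    (Ltil : Matrix (Fin (p + 1)) (Fin (p + 1)) ℝ)
    (hLtil0 : ∀ j, Ltil 0 j = -(L⁻¹ 0 j))
    (hLtilS : ∀ (m : Fin p) (j : Fin (p + 1)),
      Ltil m.succ j = L⁻¹ m.castSucc j - L⁻¹ m.succ j)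
    (f : ℝ → ℝ → ℝ) (Λ : NNReal)
    (hf : ContDiff ℝ (2 * p + 1) (Function.uncurry f))
    (hLip : ∀ t, LipschitzWith Λ (f t))
    (T : ℝ) (hT : 0 < T) (u : ℝ → ℝ) (u0 : ℝ)
    (hu : ∀ t ∈ Set.Icc (0 : ℝ) T, HasDerivAt u (f t (u t)) t)
    (hu0 : u 0 = u0)
    (uN : ℕ → ℕ → ℝ) (UU : ℕ → ℕ → ℕ → Fin (p + 1) → ℝ)
    (huN0 : ∀ N : ℕ, 1 ≤ N → uN N 0 = u0)
    (hUU0 : ∀ N : ℕ, 1 ≤ N → ∀ n < N, ∀ m, UU N n 0 m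
      = uN N n + (T / N / 2 * (s m + 1)) * f (n * (T / N)) (uN N n))
    (hUUk0 : ∀ N : ℕ, 1 ≤ N → ∀ n < N, ∀ k : ℕ, UU N n (k + 1) 0
      = uN N n + T / N / 2 * ∑ j, Ltil 0 j * ω j
          * f (n * (T / N) + T / N / 2 * (s j + 1)) (UU N n k j))
    (hUUkS : ∀ N : ℕ, 1 ≤ N → ∀ n < N, ∀ k : ℕ, ∀ m : Fin p, UU N n (k + 1) m.succ
      = UU N n (k + 1) m.castSucc
        + T / N / 2 * ω m.castSucc
          * (f (n * (T / N) + T / N / 2 * (s m.castSucc + 1)) (UU N n (k + 1) m.castSucc)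
            - f (n * (T / N) + T / N / 2 * (s m.castSucc + 1)) (UU N n k m.castSucc))
        + T / N / 2 * ∑ j, Ltil m.succ j * ω j
          * f (n * (T / N) + T / N / 2 * (s j + 1)) (UU N n k j))
    (hstep : ∀ N : ℕ, 1 ≤ N → ∀ n < N, uN N (n + 1) = UU N n K (Fin.last p)) :
    ∃ C > 0, ∃ N₀ : ℕ, ∀ N : ℕ, N₀ ≤ N → ∀ n ≤ N,
      |u (n * (T / N)) - uN N n| ≤ C * (T / N) ^ (min (2 * p + 1) (K + 1)) := by
  have R : SDGRule p s ω ℓ L := ⟨hs, hs0, hsp, hexact, hdeg, hval, hLdef, hLinv⟩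
  have hu' : ∀ t ∈ Set.Icc 0 T, HasDerivWithinAt u (f t (u t)) (Set.Icc 0 T) t :=
    fun t ht => (hu t ht).hasDerivWithinAt
  obtain ⟨D, G, h₀, hD, hG, hh₀, H⟩ := IsSDGIteration.exists_step_bound R hLtil0 hLtilS hT
    (by exact_mod_cast hf) hLip hu' K
  obtain ⟨N₀, hN₀⟩ := exists_nat_gt (T / h₀)
  refine ⟨T * D * Real.exp (G * T) + 1, by positivity, N₀, fun N hN n hn => ?_⟩
  set r := min (2 * p + 1) (K + 1)
  have hNr : T / h₀ < N := hN₀.trans_le (by exact_mod_cast hN)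
  have hN0 : (0 : ℝ) < N := (by positivity : 0 < T / h₀).trans hNr
  have hN1 : 1 ≤ N := by exact_mod_cast hN0
  set h := T / N with hh
  have hhpos : 0 < h := by positivity
  have hhle : h ≤ h₀ := by
    rw [hh, div_le_iff₀ hN0]
    rw [div_lt_iff₀ hh₀] at hNr
    linarith
  have hNh : N * h = T := by rw [hh]; field_simp
  have hrec := le_of_affine_recurrence (e := fun n => |u (n * h) - uN N n|) (N := N) hhpos.le hG
    (D := D * h ^ (r + 1)) (by positivity) (by simp [hu0, huN0 N hN1]) fun m hm => by
      have hmh : m * h + h ≤ T := by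
        have : ((m + 1 : ℕ) : ℝ) * h ≤ N * h := by gcongr; exact hm
        push_cast at this
        linarith
      have hiter : IsSDGIteration s ω Ltil f h (m * h) (uN N m) (UU N m) :=
        ⟨hUU0 N hN1 m hm, hUUk0 N hN1 m hm, hUUkS N hN1 m hm⟩
      have := H (m * h) h (uN N m) (UU N m) (by positivity) hhpos hhle hmh hiter
      rw [← hstep N hN1 m hm] at this
      simpa only [Nat.cast_succ, add_one_mul] using this
  have hnh : n * h ≤ T := by
    rw [← hNh]
    gcongr
  calc |u (n * h) - uN N n| ≤ n * (D * h ^ (r + 1)) * Real.exp (G * (n * h)) := hrec n hn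
    _ = n * h * D * Real.exp (G * (n * h)) * h ^ r := by ring
    _ ≤ T * D * Real.exp (G * T) * h ^ r := by gcongr
    _ ≤ (T * D * Real.exp (G * T) + 1) * h ^ r := by gcongr; linarith
end
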